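/- Let h : T^k × D^n → T^k × D^n be a homeomorphism which is homotopic rel T^k × ∂D^n to the identity map. Then there exist an integer λ ≥ 1 and a homeomorphism h̃ : T^k × D^n → T^k × D^n with (p_λ × 1_{D^n}) ∘ h̃ = h ∘ (p_λ × 1_{D^n}) which restricts to the identity on T^k × ∂D^n and is isotopic rel T^k × ∂D^n to the identity: there is a continuous H : (T^k × D^n) × [0,1] → T^k × D^n with H(·, 0) = h̃, H(·, 1) = id, such that H(·, t) is a homeomorphism for every t and H(x, t) = x for every x ∈ T^k × ∂D^n and every t. -/

import Mathlib

open unitInterval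

/-- The `k`-dimensional torus `T^k = (ℝ/ℤ)^k`, a compact topological abelian group,
equipped with the product (sup) metric coming from the quotient metric on `ℝ/ℤ`. -/
abbrev Torus (k : ℕ) := Fin k → AddCircle (1 : ℝ)

/-- The closed unit ball `D^n ⊆ ℝ^n`. -/
abbrev Disk (n : ℕ) := (Metric.closedBall (0 : EuclideanSpace ℝ (Fin n)) 1 :
  Set (EuclideanSpace ℝ (Fin n)))

/-- The subset `T^k × ∂D^n` of `T^k × D^n`. -/
def torusDiskBoundary (k n : ℕ) : Set (Torus k × Disk n) :=
  {p : Torus k × Disk n | ‖(p.2 : EuclideanSpace ℝ (Fin n))‖ = 1}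

/-- The covering `p_λ × 1 : T^k × D^n → T^k × D^n`. -/
noncomputable def plamDisk (k n lam : ℕ) : Torus k × Disk n → Torus k × Disk n :=
  fun p => (lam • p.1, p.2)

/-- Self-homeomorphisms of `ℝ^ι`, a group under composition. -/
abbrev CoordHomeo (ι : Type*) := (ι → ℝ) ≃ₜ (ι → ℝ)

namespace CoordHomeo

variable {ι : Type*}

/-- `g` is the identity outside `S`. -/
def FixesOff (S : Set (ι → ℝ)) (g : CoordHomeo ι) : Prop := ∀ x ∉ S, g x = x

/-- `g` moves every coordinate by at most `D`. -/
def DispLE (D : ℝ) (g : CoordHomeo ι) : Prop := ∀ x i, |g x i - x i| ≤ D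

/-- The points whose coordinates indexed by `A` lie strictly between `p` and `p + l`. -/
def openBox (A : Finset ι) (p : ι → ℝ) (l : ι → ℕ) : Set (ι → ℝ) :=
  {x | ∀ i ∈ A, p i < x i ∧ x i < p i + l i}

/-- `g` commutes with the translation by `l i` in each coordinate direction `i ∈ A`. -/
def Periodic [DecidableEq ι] (A : Finset ι) (l : ι → ℕ) (g : CoordHomeo ι) : Prop :=
  ∀ i ∈ A, ∀ x, g (x + Pi.single i (l i : ℝ)) = g x + Pi.single i (l i : ℝ)

lemma FixesOff.mul {S : Set (ι → ℝ)} {g g' : CoordHomeo ι} (h : FixesOff S g)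
    (h' : FixesOff S g') : FixesOff S (g * g') := fun x hx => by
  rw [Homeomorph.mul_apply, h' x hx, h x hx]

lemma FixesOff.symm {S : Set (ι → ℝ)} {g : CoordHomeo ι} (h : FixesOff S g) :
    FixesOff S g.symm := fun x hx => by
  rw [Homeomorph.symm_apply_eq, h x hx]

lemma FixesOff.mono {S T : Set (ι → ℝ)} {g : CoordHomeo ι} (h : FixesOff S g) (hST : S ⊆ T) :
    FixesOff T g := fun x hx => h x fun hS => hx (hST hS)

lemma FixesOff.mapsTo {S : Set (ι → ℝ)} {g : CoordHomeo ι} (h : FixesOff S g) {x : ι → ℝ}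
    (hx : x ∈ S) : g x ∈ S := by
  by_contra hgx
  have := g.injective (h _ hgx)
  exact hgx (this.symm ▸ hx)

lemma DispLE.symm {D : ℝ} {g : CoordHomeo ι} (h : DispLE D g) : DispLE D g.symm := fun x i => by
  have := h (g.symm x) i
  rwa [Homeomorph.apply_symm_apply, abs_sub_comm] at this

lemma DispLE.mul {D D' : ℝ} {g g' : CoordHomeo ι} (h : DispLE D g) (h' : DispLE D' g') :
    DispLE (D + D') (g * g') := fun x i => by
  rw [Homeomorph.mul_apply]
  have h1 := h (g' x) i
  have h2 := h' x i
  have := abs_add_le (g (g' x) i - g' x i) (g' x i - x i)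
  rw [sub_add_sub_cancel] at this
  linarith

section box

variable {A : Finset ι} {p : ι → ℝ} {l : ι → ℕ}

lemma FixesOff.apply_mem_Ico {g : CoordHomeo ι} (hg : FixesOff (openBox A p l) g) {y : ι → ℝ}
    (hy : ∀ i ∈ A, p i ≤ y i ∧ y i < p i + l i) :
    ∀ i ∈ A, p i ≤ g y i ∧ g y i < p i + l i := by
  by_cases hyb : y ∈ openBox A p l
  · exact fun i hi => ⟨(hg.mapsTo hyb i hi).1.le, (hg.mapsTo hyb i hi).2⟩
  · rwa [hg y hyb]

lemma exists_wall_notMem_openBox {S : Set (ι → ℝ)} {x : ι → ℝ}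
    (hx : ∃ i ∈ A, x i = p i ∨ x i = p i + l i) : x ∉ S ∩ openBox A p l := by
  rintro ⟨-, hb⟩
  obtain ⟨i, hi, h | h⟩ := hx
  · exact (hb i hi).1.ne' h
  · exact (hb i hi).2.ne h

end box

variable [DecidableEq ι]

lemma Periodic.nsmul {A : Finset ι} {l : ι → ℕ} {g : CoordHomeo ι} (h : Periodic A l g)
    {i : ι} (hi : i ∈ A) (m : ℕ) (x : ι → ℝ) :
    g (x + Pi.single i ((m * l i : ℕ) : ℝ)) = g x + Pi.single i ((m * l i : ℕ) : ℝ) := by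
  induction m with
  | zero => simp
  | succ m ih =>
    have : (Pi.single i (((m + 1) * l i : ℕ) : ℝ) : ι → ℝ)
        = Pi.single i ((m * l i : ℕ) : ℝ) + Pi.single i (l i : ℝ) := by
      rw [← Pi.single_add]; congr 1; push_cast; ring
    rw [this, ← add_assoc, h i hi, ih, add_assoc]

lemma Periodic.of_dvd {A : Finset ι} {l l' : ι → ℕ} {g : CoordHomeo ι} (h : Periodic A l g)
    (hl : ∀ i ∈ A, l i ∣ l' i) : Periodic A l' g := fun i hi x => by
  obtain ⟨m, hm⟩ := hl i hi
  rw [hm, mul_comm]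
  exact h.nsmul hi m x

lemma Periodic.mul {A : Finset ι} {l : ι → ℕ} {g g' : CoordHomeo ι} (h : Periodic A l g)
    (h' : Periodic A l g') : Periodic A l (g * g') := fun i hi x => by
  rw [Homeomorph.mul_apply, h' i hi, h i hi, Homeomorph.mul_apply]

lemma Periodic.symm {A : Finset ι} {l : ι → ℕ} {g : CoordHomeo ι} (h : Periodic A l g) :
    Periodic A l g.symm := fun i hi x => by
  rw [Homeomorph.symm_apply_eq, h i hi, Homeomorph.apply_symm_apply]

/-- Translate the coordinates indexed by `A` by multiples of `l` into `[p, p + l)`. -/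
noncomputable def fold (A : Finset ι) (p : ι → ℝ) (l : ι → ℕ) (x : ι → ℝ) : ι → ℝ :=
  fun i => if i ∈ A then p i + l i * Int.fract ((x i - p i) / l i) else x i

section fold

variable {A : Finset ι} {p : ι → ℝ} {l : ι → ℕ}

lemma fold_of_notMem {x : ι → ℝ} {i : ι} (hi : i ∉ A) : fold A p l x i = x i := if_neg hi

lemma fold_of_mem {x : ι → ℝ} {i : ι} (hi : i ∈ A) :
    fold A p l x i = p i + l i * Int.fract ((x i - p i) / l i) := if_pos hi

lemma fold_mem_Ico (hl : ∀ i ∈ A, 0 < l i) (x : ι → ℝ) {i : ι} (hi : i ∈ A) :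
    p i ≤ fold A p l x i ∧ fold A p l x i < p i + l i := by
  rw [fold_of_mem hi]
  have h0 : (0 : ℝ) < l i := by exact_mod_cast hl i hi
  have h1 := Int.fract_nonneg ((x i - p i) / l i)
  have h2 := Int.fract_lt_one ((x i - p i) / l i)
  constructor <;> nlinarith

lemma sub_fold (hl : ∀ i ∈ A, 0 < l i) (x : ι → ℝ) {i : ι} (hi : i ∈ A) :
    x i - fold A p l x i = l i * ⌊(x i - p i) / l i⌋ := by
  rw [fold_of_mem hi, Int.fract]
  have h0 : (l i : ℝ) ≠ 0 := by exact_mod_cast (hl i hi).ne'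
  field_simp
  ring

lemma fold_eq_of_sub_eq (hl : ∀ i ∈ A, 0 < l i) {x y : ι → ℝ} {m : ι → ℤ}
    (hy : ∀ i ∈ A, p i ≤ y i ∧ y i < p i + l i) (hA : ∀ i ∈ A, x i = y i + l i * m i)
    (hA' : ∀ i ∉ A, x i = y i) : fold A p l x = y := by
  funext i
  by_cases hi : i ∈ A
  · have h0 : (0 : ℝ) < l i := by exact_mod_cast hl i hi
    have hy' := hy i hi
    rw [fold_of_mem hi, hA i hi]
    have : (y i + l i * m i - p i) / l i = (y i - p i) / l i + m i := by field_simp; ring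
    rw [this, Int.fract_add_intCast, Int.fract_eq_self.2]
    · field_simp; ring
    · constructor
      · exact div_nonneg (by linarith) h0.le
      · rw [div_lt_one h0]; linarith
  · rw [fold_of_notMem hi, hA' i hi]

lemma fold_add_single (hl : ∀ i ∈ A, 0 < l i) (x : ι → ℝ) {i : ι} (hi : i ∈ A) :
    fold A p l (x + Pi.single i (l i : ℝ)) = fold A p l x := by
  have h0 : (l i : ℝ) ≠ 0 := by exact_mod_cast (hl i hi).ne'
  funext k
  by_cases hk : k ∈ A
  · rw [fold_of_mem hk, fold_of_mem hk]
    by_cases hki : k = i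
    · subst hki
      have : ((x + Pi.single k (l k : ℝ) : ι → ℝ) k - p k) / l k = (x k - p k) / l k + (1 : ℤ) := by
        simp; field_simp; ring
      rw [this, Int.fract_add_intCast]
    · simp [hki]
  · have : k ≠ i := fun h => hk (h ▸ hi)
    rw [fold_of_notMem hk, fold_of_notMem hk]
    simp [this]

lemma fold_singleton {j : ι} (x : ι → ℝ) :
    fold {j} p l x = Function.update x j (p j + l j * Int.fract ((x j - p j) / l j)) := by
  funext i
  by_cases hi : i = j
  · subst hi; simp [fold]
  · simp [fold, hi]

lemma fold_insert {j : ι} (hj : j ∉ A) (x : ι → ℝ) :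
    fold (insert j A) p l x = fold {j} p l (fold A p l x) := by
  funext i
  by_cases hi : i = j
  · subst hi; simp [fold, hj]
  · simp [fold, hi]

lemma fold_insert' {j : ι} (hj : j ∉ A) (x : ι → ℝ) :
    fold (insert j A) p l x = fold A p l (fold {j} p l x) := by
  funext i
  by_cases hi : i = j
  · subst hi; simp [fold, hj]
  · simp [fold, hi]

lemma fold_congr {p' : ι → ℝ} {l' : ι → ℕ} (hp : ∀ i ∈ A, p i = p' i)
    (hl : ∀ i ∈ A, l i = l' i) : fold A p l = fold A p' l' := by
  funext x i
  by_cases hi : i ∈ A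
  · rw [fold_of_mem hi, fold_of_mem hi, hp i hi, hl i hi]
  · rw [fold_of_notMem hi, fold_of_notMem hi]

lemma continuous_comp_fold {X V : Type*} [TopologicalSpace X] [TopologicalSpace V] [Zero V]
    (A : Finset ι) (hl : ∀ i ∈ A, 0 < l i) (F : X × (ι → ℝ) → V) (hF : Continuous F)
    (hw : ∀ t x, (∃ i ∈ A, x i = p i ∨ x i = p i + l i) → F (t, x) = 0) :
    Continuous fun q : X × (ι → ℝ) => F (q.1, fold A p l q.2) := by
  induction A using Finset.induction_on generalizing F with
  | empty => exact hF
  | insert j A hj ih =>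
    simp only [fold_insert hj]
    refine ih (fun i hi => hl i (Finset.mem_insert_of_mem hi))
      (fun q => F (q.1, fold {j} p l q.2)) ?_ ?_
    · simp only [fold_singleton]
      refine ContinuousOn.comp_fract (s := fun q : X × (ι → ℝ) => (q.2 j - p j) / l j)
        (f := fun q τ => F (q.1, Function.update q.2 j (p j + l j * τ))) ?_ (by fun_prop) ?_
      · refine (hF.comp ?_).continuousOn
        refine Continuous.prodMk (by fun_prop) ?_
        exact Continuous.update (by fun_prop) j (by fun_prop)
      · intro q
        rw [hw _ _ ⟨j, by simp⟩, hw _ _ ⟨j, by simp⟩]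
    · rintro t x ⟨i, hi, hx⟩
      refine hw _ _ ⟨i, Finset.mem_insert_of_mem hi, ?_⟩
      have : i ∉ ({j} : Finset ι) := by
        rw [Finset.mem_singleton]; rintro rfl; exact hj hi
      rwa [fold_of_notMem this]

end fold

/-- `e` is the `l`-periodic extension, in the directions `A`, of the restriction of `g` to the box
`[p, p + l]`. -/
def IsPeriodization (A : Finset ι) (p : ι → ℝ) (l : ι → ℕ) (g e : CoordHomeo ι) : Prop :=
  ∀ x, e x = x + (g (fold A p l x) - fold A p l x)

section periodization

variable {A : Finset ι} {p : ι → ℝ} {l : ι → ℕ} {g e : CoordHomeo ι}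

lemma FixesOff.fold_add_disp (hl : ∀ i ∈ A, 0 < l i) (hg : FixesOff (openBox A p l) g)
    (x : ι → ℝ) :
    fold A p l (x + (g (fold A p l x) - fold A p l x)) = g (fold A p l x) := by
  refine fold_eq_of_sub_eq (m := fun i => ⌊(x i - p i) / l i⌋) hl
    (hg.apply_mem_Ico fun i hi => fold_mem_Ico hl x hi) (fun i hi => ?_) fun i hi => ?_
  · rw [← sub_fold hl x hi]
    simp only [Pi.add_apply, Pi.sub_apply]; ring
  · simp [fold_of_notMem hi]

lemma FixesOff.continuous_periodization (hl : ∀ i ∈ A, 0 < l i)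
    (hg : FixesOff (openBox A p l) g) :
    Continuous fun x => x + (g (fold A p l x) - fold A p l x) := by
  refine continuous_id.add ?_
  have := continuous_comp_fold (X := Unit) (p := p) A hl (fun q => g q.2 - q.2) (by fun_prop)
    (fun t x hx => by
      have : x ∉ openBox A p l := by
        simpa using exists_wall_notMem_openBox (S := Set.univ) hx
      simp [hg x this])
  exact this.comp (continuous_const.prodMk continuous_id : Continuous fun x => ((), x))

lemma FixesOff.exists_isPeriodization (hl : ∀ i ∈ A, 0 < l i)
    (hg : FixesOff (openBox A p l) g) : ∃ e : CoordHomeo ι, IsPeriodization A p l g e := by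
  refine ⟨{ toFun := fun x => x + (g (fold A p l x) - fold A p l x)
            invFun := fun x => x + (g.symm (fold A p l x) - fold A p l x)
            left_inv := fun x => ?_
            right_inv := fun x => ?_
            continuous_toFun := hg.continuous_periodization hl
            continuous_invFun := hg.symm.continuous_periodization hl }, fun x => rfl⟩
  · beta_reduce
    rw [hg.fold_add_disp hl, Homeomorph.symm_apply_apply]; abel
  · beta_reduce
    rw [hg.symm.fold_add_disp hl, Homeomorph.apply_symm_apply]; abel

namespace IsPeriodization

lemma unique {e' : CoordHomeo ι} (h : IsPeriodization A p l g e)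
    (h' : IsPeriodization A p l g e') : e = e' :=
  Homeomorph.ext fun x => by rw [h, h']

lemma congr {p' : ι → ℝ} {l' : ι → ℕ} (h : IsPeriodization A p l g e)
    (hp : ∀ i ∈ A, p i = p' i) (hl : ∀ i ∈ A, l i = l' i) : IsPeriodization A p' l' g e :=
  fun x => by rw [h x, fold_congr hp hl]

lemma one : IsPeriodization A p l 1 (1 : CoordHomeo ι) := fun x => by simp

lemma mul {g' e' : CoordHomeo ι} (hl : ∀ i ∈ A, 0 < l i) (hg' : FixesOff (openBox A p l) g')
    (h : IsPeriodization A p l g e) (h' : IsPeriodization A p l g' e') :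
    IsPeriodization A p l (g * g') (e * e') := fun x => by
  rw [Homeomorph.mul_apply, h, h', hg'.fold_add_disp hl, Homeomorph.mul_apply]
  abel

lemma dispLE {D : ℝ} (h : IsPeriodization A p l g e) (hg : DispLE D g) : DispLE D e :=
  fun x i => by rw [h x]; simpa using hg (fold A p l x) i

lemma periodic (hl : ∀ i ∈ A, 0 < l i) (h : IsPeriodization A p l g e) : Periodic A l e :=
  fun i hi x => by rw [h, h, fold_add_single hl x hi]; abel

lemma fixesOff {S : Set (ι → ℝ)} (hS : ∀ x ∈ S, ∀ y, (∀ i ∉ A, y i = x i) → y ∈ S)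
    (h : IsPeriodization A p l g e) (hg : FixesOff S g) : FixesOff S e := fun x hx => by
  rw [h, hg, sub_self, add_zero]
  exact fun hf => hx (hS _ hf x fun i hi => (fold_of_notMem hi).symm)

lemma singleton_of_insert {E : CoordHomeo ι} {j : ι} (hj : j ∉ A)
    (h : IsPeriodization A p l g e) (h' : IsPeriodization (insert j A) p l g E) :
    IsPeriodization {j} p l e E := fun x => by
  rw [h', h, fold_insert' hj]
  abel

end IsPeriodization

end periodization

end CoordHomeo

/-- An increasing homeomorphism from `ℝ` onto `(-1, 1)`. -/
noncomputable def squash (z : ℝ) : ℝ := z / (1 + |z|)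

lemma continuous_squash : Continuous squash :=
  continuous_id.div (by fun_prop) fun z => by positivity

lemma abs_squash (z : ℝ) : |squash z| = |z| / (1 + |z|) := by
  rw [squash, abs_div, abs_of_pos (show 0 < 1 + |z| by positivity)]

lemma abs_squash_lt_one (z : ℝ) : |squash z| < 1 := by
  rw [abs_squash, div_lt_one (by positivity)]; linarith

lemma one_sub_abs_squash (z : ℝ) : 1 - |squash z| = 1 / (1 + |z|) := by
  rw [abs_squash]
  have : 0 < 1 + |z| := by positivity
  field_simp; ring

lemma squash_div_one_sub_abs {w : ℝ} (hw : |w| < 1) : squash (w / (1 - |w|)) = w := by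
  have h : 0 < 1 - |w| := by linarith
  rw [squash, abs_div, abs_of_pos h]
  field_simp
  ring

lemma squash_div_one_sub_abs_squash (z : ℝ) : squash z / (1 - |squash z|) = z := by
  rw [one_sub_abs_squash, squash]
  have : 0 < 1 + |z| := by positivity
  field_simp

lemma abs_squash_sub (z z' : ℝ) :
    |squash z - squash z'| = |z - z' + (z * |z'| - z' * |z|)| / ((1 + |z|) * (1 + |z'|)) := by
  have h : 0 < 1 + |z| := by positivity
  have h' : 0 < 1 + |z'| := by positivity
  rw [show squash z - squash z' = (z - z' + (z * |z'| - z' * |z|)) / ((1 + |z|) * (1 + |z'|)) by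
    unfold squash; field_simp; ring, abs_div, abs_of_pos (mul_pos h h')]

lemma abs_sub_le_mul_abs_squash_sub (z z' : ℝ) :
    |z - z'| ≤ (1 + |z|) * (1 + |z'|) * |squash z - squash z'| := by
  have h : 0 < 1 + |z| := by positivity
  have h' : 0 < 1 + |z'| := by positivity
  rw [abs_squash_sub, mul_div_cancel₀ _ (by positivity)]
  rcases abs_cases z with ⟨hz, hz'⟩ | ⟨hz, hz'⟩ <;> rcases abs_cases z' with ⟨hw, hw'⟩ | ⟨hw, hw'⟩ <;>
    rw [hz, hw]
  · apply le_of_eq; congr 1; ring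
  · rw [abs_of_pos (by linarith), abs_of_pos (by nlinarith)]; nlinarith
  · rw [abs_of_neg (by linarith), abs_of_neg (by nlinarith)]; nlinarith
  · apply le_of_eq; congr 1; ring

lemma abs_squash_sub_le (z z' : ℝ) :
    |squash z - squash z'| ≤ 3 * |z - z'| / (1 + |z|) := by
  have h : 0 < 1 + |z| := by positivity
  have h' : 0 < 1 + |z'| := by positivity
  rw [abs_squash_sub, div_le_div_iff₀ (by positivity) h]
  have key : |z - z' + (z * |z'| - z' * |z|)| ≤ 3 * |z - z'| * (1 + |z'|) := by
    rcases abs_cases z with ⟨hz, hz'⟩ | ⟨hz, hz'⟩ <;>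
      rcases abs_cases z' with ⟨hw, hw'⟩ | ⟨hw, hw'⟩ <;> rw [hz, hw]
    · rw [show z - z' + (z * z' - z' * z) = z - z' by ring]
      nlinarith [abs_nonneg (z - z'), mul_nonneg (abs_nonneg (z - z')) hw']
    · rw [abs_of_pos (show 0 < z - z' by linarith), abs_of_pos (by nlinarith)]
      nlinarith [mul_nonneg hz' (neg_nonneg.2 hw'.le)]
    · rw [abs_of_neg (show z - z' < 0 by linarith), abs_of_neg (by nlinarith)]
      nlinarith [mul_nonneg hw' (neg_nonneg.2 hz'.le)]
    · rw [show z - z' + (z * -z' - z' * -z) = z - z' by ring]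
      nlinarith [abs_nonneg (z - z'), mul_nonneg (abs_nonneg (z - z')) (neg_nonneg.2 hw'.le)]
  nlinarith

lemma mul_squash_sub_nonneg (z z' : ℝ) : 0 ≤ (z - z') * (squash z - squash z') := by
  have h : 0 < 1 + |z| := by positivity
  have h' : 0 < 1 + |z'| := by positivity
  have : (z - z') * (squash z - squash z') =
      ((z - z') * (z - z' + (z * |z'| - z' * |z|))) / ((1 + |z|) * (1 + |z'|)) := by
    unfold squash; field_simp; ring
  rw [this]
  refine div_nonneg ?_ (by positivity)
  rcases abs_cases z with ⟨hz, hz'⟩ | ⟨hz, hz'⟩ <;>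
    rcases abs_cases z' with ⟨hw, hw'⟩ | ⟨hw, hw'⟩ <;> rw [hz, hw]
  · nlinarith [sq_nonneg (z - z')]
  · exact mul_nonneg (by linarith) (by nlinarith)
  · exact mul_nonneg_of_nonpos_of_nonpos (by linarith) (by nlinarith)
  · nlinarith [sq_nonneg (z - z')]

lemma abs_squash_le (z : ℝ) : |squash z| ≤ 1 := (abs_squash_lt_one z).le

/-- For `t ≥ 0` an expanding homeomorphism of `ℝ`, which is `t`-Lipschitz-close to the identity
and whose expansion rate on bounded sets tends to infinity with `t`. -/
noncomputable def stretch (t z : ℝ) : ℝ := z + t * squash z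

lemma continuous_stretch : Continuous fun q : ℝ × ℝ => stretch q.1 q.2 :=
  continuous_snd.add (continuous_fst.mul (continuous_squash.comp continuous_snd))

lemma abs_add_of_mul_nonneg {a b : ℝ} (h : 0 ≤ a * b) : |a + b| = |a| + |b| :=
  (abs_add_eq_add_abs_iff a b).2 (mul_nonneg_iff.1 h)

lemma abs_sub_add_abs_squash_sub_le {t t' : ℝ} (ht : 0 ≤ t) (z z' : ℝ) :
    |z - z'| + t * |squash z - squash z'| ≤ |stretch t z - stretch t' z'| + |t - t'| := by
  have h1 : |z - z'| + t * |squash z - squash z'| = |stretch t z - stretch t z'| := by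
    rw [← abs_of_nonneg ht, ← abs_mul, abs_of_nonneg ht, ← abs_add_of_mul_nonneg]
    · unfold stretch; congr 1; ring
    · nlinarith [mul_nonneg ht (mul_squash_sub_nonneg z z')]
  have h2 : |stretch t' z' - stretch t z'| ≤ |t - t'| := by
    rw [show stretch t' z' - stretch t z' = (t' - t) * squash z' by unfold stretch; ring, abs_mul,
      abs_sub_comm]
    exact mul_le_of_le_one_right (abs_nonneg _) (abs_squash_le _)
  have h3 := abs_sub_le (stretch t z) (stretch t' z') (stretch t z')
  linarith

lemma stretch_injective {t : ℝ} (ht : 0 ≤ t) : Function.Injective (stretch t) := fun z z' h => by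
  have := abs_sub_add_abs_squash_sub_le (t' := t) ht z z'
  rw [h, sub_self, sub_self, abs_zero] at this
  have h2 := mul_nonneg ht (abs_nonneg (squash z - squash z'))
  have := abs_nonneg (z - z')
  exact sub_eq_zero.1 (abs_eq_zero.1 (by linarith))

lemma abs_le_abs_stretch {t : ℝ} (ht : 0 ≤ t) (z : ℝ) : |z| ≤ |stretch t z| := by
  have := abs_sub_add_abs_squash_sub_le (t' := t) ht z 0
  have h2 := mul_nonneg ht (abs_nonneg (squash z - squash 0))
  simp only [sub_zero, sub_self, abs_zero, add_zero] at this h2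
  have h3 : stretch t 0 = 0 := by simp [stretch, squash]
  rw [h3, sub_zero] at this
  linarith

lemma stretch_surjective (t : ℝ) : Function.Surjective (stretch t) := by
  have hc : Continuous (stretch t) :=
    continuous_stretch.comp (continuous_const.prodMk continuous_id : Continuous fun z => (t, z))
  have hb : ∀ z, |t * squash z| ≤ |t| := fun z => by
    rw [abs_mul]; exact mul_le_of_le_one_right (abs_nonneg _) (abs_squash_le _)
  refine hc.surjective ?_ ?_
  · refine Filter.tendsto_atTop_mono (f := fun z => z + -|t|) (fun z => ?_)
      (Filter.tendsto_atTop_add_const_right _ _ Filter.tendsto_id)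
    have := neg_abs_le (t * squash z); have := hb z
    simp only [stretch]; linarith
  · refine Filter.tendsto_atBot_mono (g := stretch t) (f := fun z => z + |t|) (fun z => ?_)
      (Filter.tendsto_atBot_add_const_right _ _ Filter.tendsto_id)
    have := le_abs_self (t * squash z); have := hb z
    simp only [stretch]; linarith

/-- The inverse of `stretch t`. -/
noncomputable def shrink (t : ℝ) : ℝ → ℝ := Function.surjInv (stretch_surjective t)

lemma stretch_shrink (t y : ℝ) : stretch t (shrink t y) = y :=
  Function.surjInv_eq (stretch_surjective t) y

lemma shrink_stretch {t : ℝ} (ht : 0 ≤ t) (z : ℝ) : shrink t (stretch t z) = z :=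
  stretch_injective ht (stretch_shrink t _)

lemma shrink_zero_left (y : ℝ) : shrink 0 y = y := by
  simpa [stretch] using stretch_shrink 0 y

lemma abs_shrink_sub_le {t t' : ℝ} (ht : 0 ≤ t) (y y' : ℝ) :
    |shrink t y - shrink t' y'| ≤ |y - y'| + |t - t'| := by
  have := abs_sub_add_abs_squash_sub_le (t' := t') ht (shrink t y) (shrink t' y')
  rw [stretch_shrink, stretch_shrink] at this
  have := mul_nonneg ht (abs_nonneg (squash (shrink t y) - squash (shrink t' y')))
  linarith

lemma abs_shrink_sub_mul_le {t t' : ℝ} (ht : 0 ≤ t) (y y' : ℝ) :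
    t * |shrink t y - shrink t' y'| ≤
      (1 + |shrink t y|) * (1 + |shrink t' y'|) * (|y - y'| + |t - t'|) := by
  have h1 := abs_sub_add_abs_squash_sub_le (t' := t') ht (shrink t y) (shrink t' y')
  rw [stretch_shrink, stretch_shrink] at h1
  have h2 := abs_sub_le_mul_abs_squash_sub (shrink t y) (shrink t' y')
  have h3 := abs_nonneg (shrink t y - shrink t' y')
  have h4 : 0 ≤ (1 + |shrink t y|) * (1 + |shrink t' y'|) := by positivity
  calc t * |shrink t y - shrink t' y'|
      ≤ t * ((1 + |shrink t y|) * (1 + |shrink t' y'|) *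
          |squash (shrink t y) - squash (shrink t' y')|) := by gcongr
    _ = (1 + |shrink t y|) * (1 + |shrink t' y'|) *
          (t * |squash (shrink t y) - squash (shrink t' y')|) := by ring
    _ ≤ _ := mul_le_mul_of_nonneg_left (by linarith) h4

/-- The signed distance from `s` to `[-R, R]`. -/
noncomputable def excess (R s : ℝ) : ℝ := s - max (-R) (min s R)

lemma continuous_excess (R : ℝ) : Continuous (excess R) := by unfold excess; fun_prop

lemma excess_of_abs_le {R s : ℝ} (h : |s| ≤ R) : excess R s = 0 := by
  rw [abs_le] at h
  rw [excess, min_eq_left h.2, max_eq_right h.1, sub_self]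

lemma excess_of_le {R s : ℝ} (hR : 0 ≤ R) (h : R ≤ s) : excess R s = s - R := by
  rw [excess, min_eq_right h, max_eq_right (by linarith)]

lemma excess_of_le_neg {R s : ℝ} (hR : 0 ≤ R) (h : s ≤ -R) : excess R s = s + R := by
  rw [excess, min_eq_left (by linarith), max_eq_left h, sub_neg_eq_add]

lemma excess_cases {R : ℝ} (hR : 0 ≤ R) (s : ℝ) :
    (|s| ≤ R ∧ excess R s = 0) ∨ (R < s ∧ excess R s = s - R) ∨
      (s < -R ∧ excess R s = s + R) := by
  by_cases h : |s| ≤ R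
  · exact .inl ⟨h, excess_of_abs_le h⟩
  · rcases lt_abs.1 (not_le.1 h) with h | h
    · exact .inr (.inl ⟨h, excess_of_le hR h.le⟩)
    · exact .inr (.inr ⟨by linarith, excess_of_le_neg hR (by linarith)⟩)

lemma abs_excess_sub_le {R : ℝ} (hR : 0 ≤ R) (s s' : ℝ) :
    |excess R s - excess R s'| ≤ |s - s'| := by
  rcases excess_cases hR s with ⟨h, e⟩ | ⟨h, e⟩ | ⟨h, e⟩ <;>
  rcases excess_cases hR s' with ⟨h', e'⟩ | ⟨h', e'⟩ | ⟨h', e'⟩ <;> rw [e, e'] <;>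
  (try simp only [abs_le] at h h') <;>
  rcases abs_cases (s - s') with ⟨a, a'⟩ | ⟨a, a'⟩ <;> rw [a, abs_le] <;> constructor <;> linarith

/-- `max (|s| - R) 0`. -/
lemma abs_excess {R : ℝ} (hR : 0 ≤ R) (s : ℝ) : |excess R s| = max (|s| - R) 0 := by
  rcases excess_cases hR s with ⟨h, e⟩ | ⟨h, e⟩ | ⟨h, e⟩
  · rw [e, abs_zero, max_eq_right (by linarith)]
  · rw [e, abs_of_pos (by linarith), abs_of_pos (show 0 < s by linarith),
      max_eq_left (by linarith)]
  · rw [e, abs_of_neg (by linarith), abs_of_neg (show s < 0 by linarith),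
      max_eq_left (by linarith)]
    ring

/-- An odd increasing homeomorphism from `ℝ` onto `(-(R + 1), R + 1)` fixing `[-R, R]`. -/
noncomputable def compress (R s : ℝ) : ℝ := s - excess R s + squash (excess R s)

/-- The inverse of `compress R` on `(-(R + 1), R + 1)`. -/
noncomputable def decompress (R v : ℝ) : ℝ :=
  v - excess R v + excess R v / (1 - |excess R v|)

lemma excess_sub_excess_add {R : ℝ} (hR : 0 ≤ R) {s w : ℝ} (h : 0 ≤ excess R s * w)
    (hw : excess R s = 0 → w = 0) : excess R (s - excess R s + w) = w := by
  rcases excess_cases hR s with ⟨h', e⟩ | ⟨h', e⟩ | ⟨h', e⟩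
  · rw [hw e, e]; simpa using e
  · rw [e] at h ⊢
    have : 0 ≤ w := nonneg_of_mul_nonneg_right h (by linarith)
    rw [excess_of_le hR (by linarith)]; ring
  · rw [e] at h ⊢
    have : w ≤ 0 := by nlinarith
    rw [excess_of_le_neg hR (by linarith)]; ring

lemma excess_compress {R : ℝ} (hR : 0 ≤ R) (s : ℝ) :
    excess R (compress R s) = squash (excess R s) := by
  refine excess_sub_excess_add hR ?_ fun h => by rw [h]; simp [squash]
  rw [squash, mul_div_assoc']
  exact div_nonneg (mul_self_nonneg _) (by positivity)

lemma abs_excess_lt_one {R : ℝ} (hR : 0 ≤ R) {v : ℝ} (hv : |v| < R + 1) : |excess R v| < 1 := by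
  rw [abs_excess hR]
  exact max_lt (by linarith) one_pos

lemma excess_decompress {R : ℝ} (hR : 0 ≤ R) {v : ℝ} (hv : |v| < R + 1) :
    excess R (decompress R v) = excess R v / (1 - |excess R v|) := by
  refine excess_sub_excess_add hR ?_ fun h => by rw [h]; simp
  rw [mul_div_assoc']
  exact div_nonneg (mul_self_nonneg _) (by linarith [abs_excess_lt_one hR hv])

lemma compress_decompress {R : ℝ} (hR : 0 ≤ R) {v : ℝ} (hv : |v| < R + 1) :
    compress R (decompress R v) = v := by
  rw [compress, excess_decompress hR hv, squash_div_one_sub_abs (abs_excess_lt_one hR hv),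
    decompress]
  ring

lemma decompress_compress {R : ℝ} (hR : 0 ≤ R) (s : ℝ) : decompress R (compress R s) = s := by
  rw [decompress, excess_compress hR, squash_div_one_sub_abs_squash, compress]
  ring

lemma abs_compress_lt {R : ℝ} (hR : 0 ≤ R) (s : ℝ) : |compress R s| < R + 1 := by
  have h := abs_excess hR (compress R s)
  rw [excess_compress hR] at h
  have := abs_squash_lt_one (excess R s)
  have := le_max_left (|compress R s| - R) 0
  linarith

lemma compress_of_abs_le {R s : ℝ} (h : |s| ≤ R) : compress R s = s := by
  simp [compress, excess_of_abs_le h, squash]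

lemma decompress_of_abs_le {R s : ℝ} (h : |s| ≤ R) : decompress R s = s := by
  simp [decompress, excess_of_abs_le h]

lemma continuous_compress (R : ℝ) : Continuous (compress R) :=
  (continuous_id.sub (continuous_excess R)).add (continuous_squash.comp (continuous_excess R))

lemma continuousAt_decompress {R : ℝ} (hR : 0 ≤ R) {v : ℝ} (hv : |v| < R + 1) :
    ContinuousAt (decompress R) v := by
  have hc := (continuous_excess R).continuousAt (x := v)
  refine (continuousAt_id.sub hc).add (hc.div (continuousAt_const.sub hc.abs) ?_)
  linarith [abs_excess_lt_one hR hv]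

lemma one_add_abs_excess_decompress {R : ℝ} (hR : 0 ≤ R) {v : ℝ} (hv : |v| < R + 1) :
    (1 + |excess R (decompress R v)|) * (1 - |excess R v|) = 1 := by
  have h := abs_excess_lt_one hR hv
  have h' : 0 < 1 - |excess R v| := by linarith
  rw [excess_decompress hR hv, abs_div, abs_of_pos h']
  field_simp
  ring

lemma abs_compress_sub_le {R : ℝ} (hR : 0 ≤ R) (s s' : ℝ) :
    |compress R s - compress R s'| ≤ 5 * |s - s'| := by
  have h1 := abs_excess_sub_le hR s s'
  have h2 := abs_squash_sub_le (excess R s) (excess R s')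
  have h3 : 3 * |excess R s - excess R s'| / (1 + |excess R s|) ≤ 3 * |excess R s - excess R s'| :=
    div_le_self (by positivity) (by linarith [abs_nonneg (excess R s)])
  have h4 : compress R s - compress R s' = (s - s') - (excess R s - excess R s') +
      (squash (excess R s) - squash (excess R s')) := by unfold compress; ring
  have h5 := abs_add_le ((s - s') - (excess R s - excess R s'))
      (squash (excess R s) - squash (excess R s'))
  have h6 := abs_sub (s - s') (excess R s - excess R s')
  rw [h4]
  linarith

lemma abs_compress_sub_mul_le {R : ℝ} (hR : 0 ≤ R) {s s' : ℝ} (h : |s - s'| < |excess R s|) :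
    (1 + |excess R s|) * |compress R s - compress R s'| ≤ 3 * |s - s'| := by
  have h1 := abs_squash_sub_le (excess R s) (excess R s')
  have key : s - excess R s = s' - excess R s' := by
    rw [abs_lt] at h
    rcases excess_cases hR s with ⟨h', e⟩ | ⟨h', e⟩ | ⟨h', e⟩
    · rw [e, abs_zero] at h; linarith
    · rw [e, abs_of_pos (by linarith)] at h
      rw [e, excess_of_le hR (by linarith)]; ring
    · rw [e, abs_of_neg (by linarith)] at h
      rw [e, excess_of_le_neg hR (by linarith)]; ring
  have hpos : 0 < 1 + |excess R s| := by positivity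
  have h2 : compress R s - compress R s' = squash (excess R s) - squash (excess R s') := by
    unfold compress; rw [key]; ring
  rw [h2]
  rw [le_div_iff₀ hpos] at h1
  have : excess R s - excess R s' = s - s' := by linarith
  rw [this] at h1
  linarith

lemma continuous_shrink_abs : Continuous fun q : ℝ × ℝ => shrink |q.1| q.2 := by
  refine (LipschitzWith.of_dist_le_mul (K := 2) fun q q' => ?_).continuous
  have h := abs_shrink_sub_le (t' := |q'.1|) (abs_nonneg q.1) q.2 q'.2
  have h1 : dist q.1 q'.1 ≤ dist q q' := le_max_left _ _
  have h2 : dist q.2 q'.2 ≤ dist q q' := le_max_right _ _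
  have h3 := abs_abs_sub_abs_le_abs_sub q.1 q'.1
  rw [Real.dist_eq] at h1 h2 ⊢
  simp only [NNReal.coe_ofNat]
  linarith

namespace CoordHomeo

variable {ι : Type*} [DecidableEq ι]

/-- A homeomorphism from `ℝ^ι` onto the slab `|x j| < R + 1`, the identity on `|x j| ≤ R`, which
contracts more and more in all directions about the axis through `c`. -/
noncomputable def toSlab (j : ι) (c : ι → ℝ) (R : ℝ) (x : ι → ℝ) : ι → ℝ := fun i =>
  if i = j then compress R (x j) else c i + shrink |excess R (x j)| (x i - c i)

/-- The inverse of `toSlab` on the slab `|x j| < R + 1`. -/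
noncomputable def ofSlab (j : ι) (c : ι → ℝ) (R : ℝ) (x : ι → ℝ) : ι → ℝ := fun i =>
  if i = j then decompress R (x j)
  else c i + stretch |excess R (decompress R (x j))| (x i - c i)

section slab

variable {j : ι} {c : ι → ℝ} {R : ℝ}

lemma toSlab_self (x : ι → ℝ) : toSlab j c R x j = compress R (x j) := if_pos rfl

lemma toSlab_of_ne {i : ι} (hi : i ≠ j) (x : ι → ℝ) :
    toSlab j c R x i = c i + shrink |excess R (x j)| (x i - c i) := if_neg hi

lemma ofSlab_self (x : ι → ℝ) : ofSlab j c R x j = decompress R (x j) := if_pos rfl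

lemma ofSlab_of_ne {i : ι} (hi : i ≠ j) (x : ι → ℝ) :
    ofSlab j c R x i = c i + stretch |excess R (decompress R (x j))| (x i - c i) := if_neg hi

lemma continuous_toSlab : Continuous (toSlab j c R) := by
  refine continuous_pi fun i => ?_
  by_cases hi : i = j
  · subst hi
    simp only [toSlab_self]
    exact (continuous_compress R).comp (continuous_apply i)
  · simp only [toSlab_of_ne hi]
    refine continuous_const.add (continuous_shrink_abs.comp (Continuous.prodMk ?_ (by fun_prop)))
    exact (continuous_excess R).comp (continuous_apply j)

lemma continuousAt_ofSlab (hR : 0 ≤ R) {x : ι → ℝ} (hx : |x j| < R + 1) :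
    ContinuousAt (ofSlab j c R) x := by
  have hd : ContinuousAt (fun y : ι → ℝ => decompress R (y j)) x :=
    (continuousAt_decompress hR hx).comp (f := fun y : ι → ℝ => y j) (continuous_apply j).continuousAt
  refine continuousAt_pi.2 fun i => ?_
  by_cases hi : i = j
  · subst hi
    simpa only [ofSlab_self] using hd
  · simp only [ofSlab_of_ne hi]
    refine continuousAt_const.add (continuous_stretch.continuousAt.comp
      (f := fun y : ι → ℝ => (|excess R (decompress R (y j))|, y i - c i)) ?_)
    refine ContinuousAt.prodMk ?_ ((continuous_apply i).sub continuous_const).continuousAt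
    exact ((continuous_excess R).continuousAt.comp hd).abs

lemma abs_toSlab_lt (hR : 0 ≤ R) (x : ι → ℝ) : |toSlab j c R x j| < R + 1 := by
  rw [toSlab_self]; exact abs_compress_lt hR _

lemma ofSlab_toSlab (hR : 0 ≤ R) (x : ι → ℝ) : ofSlab j c R (toSlab j c R x) = x := by
  funext i
  by_cases hi : i = j
  · subst hi
    rw [ofSlab_self, toSlab_self, decompress_compress hR]
  · rw [ofSlab_of_ne hi, toSlab_self, decompress_compress hR, toSlab_of_ne hi, add_sub_cancel_left,
      stretch_shrink]
    ring

lemma toSlab_ofSlab (hR : 0 ≤ R) {x : ι → ℝ} (hx : |x j| < R + 1) :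
    toSlab j c R (ofSlab j c R x) = x := by
  funext i
  by_cases hi : i = j
  · subst hi
    rw [toSlab_self, ofSlab_self, compress_decompress hR hx]
  · rw [toSlab_of_ne hi, ofSlab_self, ofSlab_of_ne hi, add_sub_cancel_left,
      shrink_stretch (abs_nonneg _)]
    ring

lemma toSlab_of_abs_le {x : ι → ℝ} (hx : |x j| ≤ R) : toSlab j c R x = x := by
  funext i
  by_cases hi : i = j
  · subst hi
    rw [toSlab_self, compress_of_abs_le hx]
  · rw [toSlab_of_ne hi, excess_of_abs_le hx, abs_zero, shrink_zero_left]
    ring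

lemma ofSlab_of_abs_le {x : ι → ℝ} (hx : |x j| ≤ R) : ofSlab j c R x = x := by
  funext i
  by_cases hi : i = j
  · subst hi
    rw [ofSlab_self, decompress_of_abs_le hx]
  · rw [ofSlab_of_ne hi, decompress_of_abs_le hx, excess_of_abs_le hx, abs_zero]
    simp [stretch]

lemma abs_le_abs_ofSlab {i : ι} (hi : i ≠ j) (x : ι → ℝ) :
    |x i - c i| ≤ |ofSlab j c R x i - c i| := by
  rw [ofSlab_of_ne hi, add_sub_cancel_left]
  exact abs_le_abs_stretch (abs_nonneg _) _

lemma abs_toSlab_sub_le (hR : 0 ≤ R) {D : ℝ} {x y : ι → ℝ} (h : ∀ i, |y i - x i| ≤ D) (i : ι) :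
    |toSlab j c R y i - toSlab j c R x i| ≤ 5 * D := by
  have hD : 0 ≤ D := (abs_nonneg _).trans (h i)
  by_cases hi : i = j
  · subst hi
    rw [toSlab_self, toSlab_self]
    exact (abs_compress_sub_le hR _ _).trans (by linarith [h i])
  · rw [toSlab_of_ne hi, toSlab_of_ne hi, add_sub_add_left_eq_sub]
    have h1 := abs_shrink_sub_le (t' := |excess R (x j)|) (abs_nonneg (excess R (y j)))
      (y i - c i) (x i - c i)
    rw [sub_sub_sub_cancel_right] at h1
    have h2 := abs_abs_sub_abs_le_abs_sub (excess R (y j)) (excess R (x j))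
    have h3 := abs_excess_sub_le hR (y j) (x j)
    linarith [h i, h j]

lemma mul_abs_toSlab_sub_le (hR : 0 ≤ R) {D : ℝ} {x y : ι → ℝ} (h : ∀ i, |y i - x i| ≤ D)
    (i : ι) :
    (1 + |excess R (x j)|) * |toSlab j c R y i - toSlab j c R x i| ≤
      5 * D * (1 + D) + 3 * D +
        (1 + |toSlab j c R x i - c i|) * (1 + |toSlab j c R x i - c i| + 2 * D) * (2 * D) := by
  have hD : 0 ≤ D := (abs_nonneg _).trans (h i)
  by_cases hi : i = j
  · subst hi
    have h0 : 0 ≤ (1 + |toSlab i c R x i - c i|) * (1 + |toSlab i c R x i - c i| + 2 * D)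
      * (2 * D) := by positivity
    suffices H : (1 + |excess R (x i)|) * |toSlab i c R y i - toSlab i c R x i| ≤
        5 * D * (1 + D) + 3 * D by linarith
    rw [toSlab_self, toSlab_self, abs_sub_comm]
    have h1 : |x i - y i| ≤ D := abs_sub_comm (x i) (y i) ▸ h i
    by_cases hlt : |x i - y i| < |excess R (x i)|
    · have := abs_compress_sub_mul_le hR hlt
      nlinarith
    · have h2 := abs_compress_sub_le hR (x i) (y i)
      have h3 := abs_nonneg (compress R (x i) - compress R (y i))
      have h4 : 1 + |excess R (x i)| ≤ 1 + D := by linarith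
      calc _ ≤ (1 + D) * (5 * D) := mul_le_mul h4 (by linarith) h3 (by linarith)
        _ ≤ _ := by linarith
  · rw [toSlab_of_ne hi, toSlab_of_ne hi, add_sub_add_left_eq_sub, add_sub_cancel_left,
      abs_sub_comm]
    set z := shrink |excess R (x j)| (x i - c i)
    set z' := shrink |excess R (y j)| (y i - c i)
    have h0 : |(x i - c i) - (y i - c i)| + |(|excess R (x j)| - |excess R (y j)|)| ≤ 2 * D := by
      rw [sub_sub_sub_cancel_right, abs_sub_comm (x i)]
      have h2 := abs_abs_sub_abs_le_abs_sub (excess R (x j)) (excess R (y j))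
      have h3 := abs_excess_sub_le hR (x j) (y j)
      rw [abs_sub_comm (x j)] at h3
      linarith [h i, h j]
    have h1 : |z - z'| ≤ 2 * D := (abs_shrink_sub_le (abs_nonneg _) _ _).trans h0
    have h2 : |excess R (x j)| * |z - z'| ≤ (1 + |z|) * (1 + |z'|) * (2 * D) :=
      (abs_shrink_sub_mul_le (abs_nonneg _) _ _).trans (by gcongr)
    have h3 : |z'| ≤ |z| + 2 * D := by
      have := abs_sub_abs_le_abs_sub z' z
      rw [abs_sub_comm] at this
      linarith
    have h4 : (1 + |z|) * (1 + |z'|) * (2 * D) ≤ (1 + |z|) * (1 + |z| + 2 * D) * (2 * D) := by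
      exact mul_le_mul_of_nonneg_right (mul_le_mul_of_nonneg_left (by linarith) (by positivity))
        (by linarith)
    nlinarith [mul_nonneg hD hD]

end slab

open Classical in
/-- Conjugate `g` into the slab `|x j| < R + 1` by `toSlab`, and extend by the identity. -/
noncomputable def truncFun (j : ι) (c : ι → ℝ) (R : ℝ) (g : CoordHomeo ι) (x : ι → ℝ) : ι → ℝ :=
  if |x j| < R + 1 then toSlab j c R (g (ofSlab j c R x)) else x

section trunc

variable {j : ι} {c : ι → ℝ} {R D : ℝ} {g : CoordHomeo ι}

lemma truncFun_of_lt {x : ι → ℝ} (hx : |x j| < R + 1) :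
    truncFun j c R g x = toSlab j c R (g (ofSlab j c R x)) := if_pos hx

lemma truncFun_of_le {x : ι → ℝ} (hx : R + 1 ≤ |x j|) : truncFun j c R g x = x :=
  if_neg (not_lt.2 hx)

lemma abs_truncFun_sub_le (hR : 0 ≤ R) (hg : DispLE D g) (x : ι → ℝ) (i : ι) :
    |truncFun j c R g x i - x i| ≤ 5 * D := by
  by_cases hx : |x j| < R + 1
  · have h := abs_toSlab_sub_le (j := j) (c := c) hR (hg (ofSlab j c R x)) i
    rwa [toSlab_ofSlab hR hx, ← truncFun_of_lt hx] at h
  · have hD : 0 ≤ D := (abs_nonneg _).trans (hg x i)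
    rw [truncFun_of_le (not_lt.1 hx), sub_self, abs_zero]
    linarith

lemma abs_truncFun_sub_le_mul (hR : 0 ≤ R) (hg : DispLE D g) (x : ι → ℝ) (i : ι) :
    |truncFun j c R g x i - x i| ≤
      (5 * D * (1 + D) + 3 * D + (1 + |x i - c i|) * (1 + |x i - c i| + 2 * D) * (2 * D)) *
        max 0 (1 - |excess R (x j)|) := by
  have hD : 0 ≤ D := (abs_nonneg _).trans (hg x i)
  by_cases hx : |x j| < R + 1
  · have h := mul_abs_toSlab_sub_le (j := j) (c := c) hR (hg (ofSlab j c R x)) i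
    rw [toSlab_ofSlab hR hx, ← truncFun_of_lt hx, ofSlab_self] at h
    have h1 := one_add_abs_excess_decompress hR hx
    have h2 := abs_excess_lt_one hR hx
    rw [max_eq_right (by linarith)]
    have h3 := mul_le_mul_of_nonneg_right h (show 0 ≤ 1 - |excess R (x j)| by linarith)
    rwa [mul_right_comm, h1, one_mul] at h3
  · rw [truncFun_of_le (not_lt.1 hx), sub_self, abs_zero]
    positivity

lemma continuous_truncFun (hR : 0 ≤ R) (hg : DispLE D g) : Continuous (truncFun j c R g) := by
  refine continuous_iff_continuousAt.2 fun x => ?_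
  by_cases hx : |x j| < R + 1
  · have hev : ∀ᶠ y : ι → ℝ in nhds x, |y j| < R + 1 :=
      (continuous_apply j).abs.continuousAt.eventually_lt_const hx
    have hc : ContinuousAt (fun y => toSlab j c R (g (ofSlab j c R y))) x :=
      (continuous_toSlab.comp g.continuous).continuousAt.comp (continuousAt_ofSlab hR hx)
    exact hc.congr (hev.mono fun y hy => (truncFun_of_lt hy).symm)
  · rw [not_lt] at hx
    refine continuousAt_pi.2 fun i => ?_
    rw [ContinuousAt, truncFun_of_le hx]
    have h1 : Filter.Tendsto (fun y : ι → ℝ => truncFun j c R g y i - y i) (nhds x) (nhds 0) := by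
      refine squeeze_zero_norm (fun y => abs_truncFun_sub_le_mul hR hg y i) ?_
      have hc : Continuous fun y : ι → ℝ =>
          (5 * D * (1 + D) + 3 * D + (1 + |y i - c i|) * (1 + |y i - c i| + 2 * D) * (2 * D)) *
            max 0 (1 - |excess R (y j)|) := by
        have := (continuous_excess R).comp (continuous_apply (A := fun _ : ι => ℝ) j)
        simp only [Function.comp_def] at this
        fun_prop
      have h0 : max 0 (1 - |excess R (x j)|) = 0 := by
        refine max_eq_left ?_
        have := le_max_left (|x j| - R) 0
        rw [abs_excess hR]
        linarith
      have := hc.tendsto x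
      rwa [h0, mul_zero] at this
    simpa using h1.add (continuous_apply i).continuousAt

lemma truncFun_symm_truncFun (hR : 0 ≤ R) (x : ι → ℝ) :
    truncFun j c R g.symm (truncFun j c R g x) = x := by
  by_cases hx : |x j| < R + 1
  · rw [truncFun_of_lt hx, truncFun_of_lt (abs_toSlab_lt hR _), ofSlab_toSlab hR,
      Homeomorph.symm_apply_apply, toSlab_ofSlab hR hx]
  · rw [truncFun_of_le (not_lt.1 hx), truncFun_of_le (not_lt.1 hx)]

/-- `S` is invariant under moving coordinates in `N` towards `c`, and under changing the other
coordinates. -/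
def Solid (c : ι → ℝ) (N : Finset ι) (S : Set (ι → ℝ)) : Prop :=
  ∀ x ∈ S, ∀ y : ι → ℝ, (∀ i ∈ N, |y i - c i| ≤ |x i - c i|) → y ∈ S

/-- A homeomorphism with bounded displacement can be cut off in a coordinate direction `j`. -/
lemma exists_trunc {N : Finset ι} {S : Set (ι → ℝ)} (hS : Solid c N S) (hj : j ∉ N)
    (hg : DispLE D g) (hgS : FixesOff S g) (hR : 0 ≤ R) :
    ∃ G : CoordHomeo ι, DispLE (5 * D) G ∧ FixesOff S G ∧
      (∀ x, R + D + 1 ≤ |x j| → G x = x) ∧ ∀ x, |x j| ≤ R → G x = g x := by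
  have hD : 0 ≤ D := (abs_nonneg _).trans (hg 0 j)
  have hRD : 0 ≤ R + D := by linarith
  refine ⟨{ toFun := truncFun j c (R + D) g
            invFun := truncFun j c (R + D) g.symm
            left_inv := truncFun_symm_truncFun hRD
            right_inv := fun x => by
              simpa using truncFun_symm_truncFun (g := g.symm) (c := c) (j := j) hRD x
            continuous_toFun := continuous_truncFun hRD hg
            continuous_invFun := continuous_truncFun hRD hg.symm },
    abs_truncFun_sub_le hRD hg, fun x hx => ?_, fun x hx => truncFun_of_le hx, fun x hx => ?_⟩
  · change truncFun j c (R + D) g x = x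
    by_cases hxj : |x j| < R + D + 1
    · rw [truncFun_of_lt hxj, hgS, toSlab_ofSlab hRD hxj]
      refine fun h => hx (hS _ h x fun i hi => abs_le_abs_ofSlab ?_ x)
      rintro rfl
      exact hj hi
    · exact truncFun_of_le (not_lt.1 hxj)
  · change truncFun j c (R + D) g x = g x
    rw [truncFun_of_lt (by linarith), ofSlab_of_abs_le (by linarith), toSlab_of_abs_le]
    have := hg x j
    have := abs_sub_abs_le_abs_sub (g x j) (x j)
    linarith

end trunc

end CoordHomeo

namespace CoordHomeo

variable {ι : Type*}

lemma Solid.cylinder {c : ι → ℝ} {N A : Finset ι} {S : Set (ι → ℝ)} (hS : Solid c N S)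
    (hAN : Disjoint A N) :
    ∀ x ∈ S, ∀ y : ι → ℝ, (∀ i ∉ A, y i = x i) → y ∈ S := fun x hx y hy =>
  hS x hx y fun i hi => by rw [hy i fun h => Finset.disjoint_left.1 hAN h hi]

variable [DecidableEq ι]

/-- `e` is the periodic extension, in the directions `A`, of a bounded homeomorphism supported in
the part of `S` lying in a box. -/
def Elem (A : Finset ι) (S : Set (ι → ℝ)) (e : CoordHomeo ι) : Prop :=
  ∃ (g : CoordHomeo ι) (p : ι → ℝ) (l : ι → ℕ) (D : ℝ), (∀ i ∈ A, 0 < l i) ∧ DispLE D g ∧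
    FixesOff (S ∩ openBox A p l) g ∧ IsPeriodization A p l g e

/-- The products of homeomorphisms satisfying `Elem`. -/
def Good (A : Finset ι) (S : Set (ι → ℝ)) : Submonoid (CoordHomeo ι) :=
  Submonoid.closure {e | Elem A S e}

lemma Periodic.zsmul {A : Finset ι} {l : ι → ℕ} {g : CoordHomeo ι} (h : Periodic A l g)
    {i : ι} (hi : i ∈ A) (m : ℤ) (x : ι → ℝ) :
    g (x + Pi.single i (l i * m : ℝ)) = g x + Pi.single i (l i * m : ℝ) := by
  obtain ⟨m, rfl | rfl⟩ := m.eq_nat_or_neg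
  · have := h.nsmul hi m x
    push_cast at this ⊢
    rwa [mul_comm]
  · have := h.nsmul hi m (x - Pi.single i ((m * l i : ℕ) : ℝ))
    rw [sub_add_cancel] at this
    push_cast at this ⊢
    rw [mul_neg, mul_comm, Pi.single_neg, ← sub_eq_add_neg, ← sub_eq_add_neg, this,
      add_sub_cancel_right]

lemma Periodic.isPeriodization {j : ι} {p : ι → ℝ} {l : ι → ℕ} {g w : CoordHomeo ι}
    (hl : 0 < l j) (h : Periodic {j} l w)
    (hg : ∀ x : ι → ℝ, p j ≤ x j → x j < p j + l j → g x = w x) :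
    IsPeriodization {j} p l g w := fun x => by
  have hl' : ∀ i ∈ ({j} : Finset ι), 0 < l i := by simpa using hl
  have hj : j ∈ ({j} : Finset ι) := Finset.mem_singleton_self j
  have hm := fold_mem_Ico (p := p) hl' x hj
  rw [hg _ hm.1 hm.2]
  have hx : x = fold {j} p l x + Pi.single j (l j * (⌊(x j - p j) / l j⌋ : ℤ) : ℝ) := by
    funext i
    by_cases hi : i = j
    · subst hi
      rw [Pi.add_apply, Pi.single_eq_same, ← sub_fold hl' x hj]
      ring
    · rw [Pi.add_apply, Pi.single_eq_of_ne hi, add_zero, fold_of_notMem (by simpa using hi)]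
  have hwx := h.zsmul hj ⌊(x j - p j) / l j⌋ (fold {j} p l x)
  rw [← hx] at hwx
  rw [hwx, eq_sub_of_add_eq' hx.symm]
  abel

namespace Solid

variable {c : ι → ℝ} {N A : Finset ι} {S : Set (ι → ℝ)}

lemma inter_openBox (hS : Solid c N S) (hAN : Disjoint A N) (p : ι → ℝ) (l : ι → ℕ) :
    Solid (fun i => if i ∈ A then p i + l i / 2 else c i) (N ∪ A) (S ∩ openBox A p l) := by
  rintro x ⟨hxS, hxb⟩ y hy
  refine ⟨hS x hxS y fun i hi => ?_, fun i hi => ?_⟩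
  · have h := hy i (Finset.mem_union_left _ hi)
    beta_reduce at h
    rwa [if_neg fun h => Finset.disjoint_left.1 hAN h hi] at h
  · have h := hy i (Finset.mem_union_right _ hi)
    beta_reduce at h
    rw [if_pos hi] at h
    have hx := hxb i hi
    have h1 : |x i - (p i + l i / 2)| < l i / 2 := abs_lt.2 ⟨by linarith, by linarith⟩
    have h2 := abs_lt.1 (h.trans_lt h1)
    exact ⟨by linarith, by linarith⟩

lemma inter_slab {j : ι} (hS : Solid c N S) (hj : j ∉ N) (lam : ℕ) :
    Solid (Function.update c j (lam / 2)) (insert j N) (S ∩ {x | 0 < x j ∧ x j < lam}) := by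
  rintro x ⟨hxS, hxb⟩ y hy
  refine ⟨hS x hxS y fun i hi => ?_, ?_⟩
  · have h := hy i (Finset.mem_insert_of_mem hi)
    rwa [Function.update_of_ne (by rintro rfl; exact hj hi)] at h
  · have h := hy j (Finset.mem_insert_self _ _)
    rw [Function.update_self] at h
    obtain ⟨h3, h4⟩ := hxb
    have h1 : |x j - lam / 2| < lam / 2 := abs_lt.2 ⟨by linarith, by linarith⟩
    have h2 := abs_lt.1 (h.trans_lt h1)
    exact ⟨by linarith, by linarith⟩

end Solid

section good

variable {A : Finset ι} {S : Set (ι → ℝ)} {e : CoordHomeo ι}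

lemma fixesOff_of_mem_good (hS : ∀ x ∈ S, ∀ y : ι → ℝ, (∀ i ∉ A, y i = x i) → y ∈ S)
    (he : e ∈ Good A S) : FixesOff S e := by
  induction he using Submonoid.closure_induction with
  | mem e he =>
    obtain ⟨g, p, l, D, hl, hD, hg, hp⟩ := he
    exact hp.fixesOff hS (hg.mono Set.inter_subset_left)
  | one => exact fun x _ => rfl
  | mul e e' _ _ he he' => exact he.mul he'

lemma exists_periodic_of_mem_good (he : e ∈ Good A S) :
    ∃ l : ι → ℕ, (∀ i ∈ A, 0 < l i) ∧ Periodic A l e := by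
  induction he using Submonoid.closure_induction with
  | mem e he =>
    obtain ⟨g, p, l, D, hl, hD, hg, hp⟩ := he
    exact ⟨l, hl, hp.periodic hl⟩
  | one => exact ⟨1, fun _ _ => Nat.one_pos, fun _ _ _ => rfl⟩
  | mul e e' _ _ he he' =>
    obtain ⟨l, hl, h⟩ := he
    obtain ⟨l', hl', h'⟩ := he'
    exact ⟨fun i => l i * l' i, fun i hi => Nat.mul_pos (hl i hi) (hl' i hi),
      (h.of_dvd fun i _ => dvd_mul_right _ _).mul (h'.of_dvd fun i _ => dvd_mul_left _ _)⟩

/-- Products of periodic extensions which are constrained to a slab extend periodically in the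
direction transverse to the slab. -/
lemma exists_isPeriodization_of_mem_good {j : ι} (hj : j ∉ A) {lam : ℕ} (hlam : 0 < lam)
    (hS : ∀ x ∈ S, ∀ y : ι → ℝ, (∀ i ∉ A, y i = x i) → y ∈ S)
    (he : e ∈ Good A (S ∩ {x | 0 < x j ∧ x j < lam})) :
    ∃ E ∈ Good (insert j A) S, IsPeriodization {j} 0 (fun _ => lam) e E := by
  have hS' : ∀ x ∈ S ∩ {x | 0 < x j ∧ x j < lam}, ∀ y : ι → ℝ, (∀ i ∉ A, y i = x i) →
      y ∈ S ∩ {x | 0 < x j ∧ x j < lam} := fun x hx y hy => by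
    refine ⟨hS x hx.1 y hy, ?_⟩
    have := hx.2
    simpa [hy j hj] using this
  induction he using Submonoid.closure_induction with
  | mem e he =>
    obtain ⟨g, p, l, D, hl, hD, hg, hp⟩ := he
    set p' := Function.update p j 0 with hp'
    set l' := Function.update l j lam with hl'
    have hne : ∀ i ∈ A, i ≠ j := by rintro i hi rfl; exact hj hi
    have hpA : ∀ i ∈ A, p i = p' i := fun i hi => by rw [hp', Function.update_of_ne (hne i hi)]
    have hlA : ∀ i ∈ A, l i = l' i := fun i hi => by rw [hl', Function.update_of_ne (hne i hi)]
    have hpj : p' j = 0 := Function.update_self ..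
    have hlj : l' j = lam := Function.update_self ..
    have hl0 : ∀ i ∈ insert j A, 0 < l' i := by
      rintro i hi
      rcases Finset.mem_insert.1 hi with rfl | hi
      · rwa [hlj]
      · rw [← hlA i hi]; exact hl i hi
    have hg' : FixesOff (S ∩ openBox (insert j A) p' l') g := hg.mono fun x hx => by
      refine ⟨hx.1.1, fun i hi => ?_⟩
      rcases Finset.mem_insert.1 hi with rfl | hi
      · rw [hpj, hlj, zero_add]; exact hx.1.2
      · rw [← hpA i hi, ← hlA i hi]; exact hx.2 i hi
    obtain ⟨E, hE⟩ := (hg'.mono Set.inter_subset_right).exists_isPeriodization hl0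
    refine ⟨E, Submonoid.subset_closure ⟨g, p', l', D, hl0, hD, hg', hE⟩, ?_⟩
    refine ((hp.congr hpA hlA).singleton_of_insert hj hE).congr ?_ ?_ <;> simp [hpj, hlj]
  | one => exact ⟨1, one_mem _, IsPeriodization.one⟩
  | mul e e' _ hm he he' =>
    obtain ⟨E, hE, h⟩ := he
    obtain ⟨E', hE', h'⟩ := he'
    refine ⟨E * E', mul_mem hE hE', h.mul (by simpa using hlam) ?_ h'⟩
    refine (fixesOff_of_mem_good hS' hm).mono fun x hx => ?_
    simpa [openBox] using hx.2

/-- Products of periodic extensions can be cut off in a further direction `j` so as to be periodic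
extensions in this direction, too. -/
lemma exists_trunc_of_mem_good {j : ι} {c : ι → ℝ} {N : Finset ι} (hj : j ∉ A) (hjN : j ∉ N)
    (hAN : Disjoint A N) (hS : Solid c N S) (he : e ∈ Good A S) :
    ∃ D, DispLE D e ∧ ∀ R, 0 ≤ R → ∃ (L : ℕ) (G : CoordHomeo ι), DispLE D G ∧
      (∀ x : ι → ℝ, (L : ℝ) ≤ |x j| → G x = x) ∧ (∀ x : ι → ℝ, |x j| ≤ R → G x = e x) ∧
      ∀ lam : ℕ, 0 < lam → 2 * L ≤ lam → ∃ E ∈ Good (insert j A) S,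
        IsPeriodization {j} (fun _ => -(lam / 2 : ℝ)) (fun _ => lam) G E := by
  induction he using Submonoid.closure_induction with
  | mem e he =>
    obtain ⟨g, p, l, D, hl, hD, hg, hp⟩ := he
    have hD0 : 0 ≤ D := (abs_nonneg _).trans (hD 0 j)
    refine ⟨5 * D, fun x i => (hp.dispLE hD x i).trans (by linarith), fun R hR => ?_⟩
    obtain ⟨G₀, hG₀, hG₀S, hG₀L, hG₀R⟩ := exists_trunc (hS.inter_openBox hAN p l)
      (j := j) (by simp [hj, hjN]) hD hg hR
    obtain ⟨G, hG⟩ := (hG₀S.mono Set.inter_subset_right).exists_isPeriodization hl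
    have hL : R + D + 1 ≤ ⌈R + D + 1⌉₊ := Nat.le_ceil _
    refine ⟨⌈R + D + 1⌉₊, G, hG.dispLE hG₀, fun x hx => ?_, fun x hx => ?_, fun lam h0 hlam => ?_⟩
    · rw [hG, hG₀L, sub_self, add_zero]
      rw [fold_of_notMem hj]; linarith
    · rw [hG, hp, hG₀R]
      rwa [fold_of_notMem hj]
    set p' := Function.update p j (-(lam / 2 : ℝ)) with hp'
    set l' := Function.update l j lam with hl'
    have hne : ∀ i ∈ A, i ≠ j := by rintro i hi rfl; exact hj hi
    have hpA : ∀ i ∈ A, p i = p' i := fun i hi => by rw [hp', Function.update_of_ne (hne i hi)]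
    have hlA : ∀ i ∈ A, l i = l' i := fun i hi => by rw [hl', Function.update_of_ne (hne i hi)]
    have hpj : p' j = -(lam / 2 : ℝ) := Function.update_self ..
    have hlj : l' j = lam := Function.update_self ..
    have hl0 : ∀ i ∈ insert j A, 0 < l' i := by
      rintro i hi
      rcases Finset.mem_insert.1 hi with rfl | hi
      · rwa [hlj]
      · rw [← hlA i hi]; exact hl i hi
    have hlam' : (2 : ℝ) * ⌈R + D + 1⌉₊ ≤ lam := by exact_mod_cast hlam
    have hG₀' : FixesOff (S ∩ openBox (insert j A) p' l') G₀ := fun x hx => by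
      by_cases hxj : R + D + 1 ≤ |x j|
      · exact hG₀L x hxj
      refine hG₀S x fun hx' => hx ⟨hx'.1, fun i hi => ?_⟩
      rcases Finset.mem_insert.1 hi with rfl | hi
      · rw [hpj, hlj]
        have := abs_lt.1 (not_le.1 hxj)
        constructor <;> linarith
      · rw [← hpA i hi, ← hlA i hi]; exact hx'.2 i hi
    obtain ⟨E, hE⟩ := (hG₀'.mono Set.inter_subset_right).exists_isPeriodization hl0
    refine ⟨E, Submonoid.subset_closure ⟨G₀, p', l', _, hl0, hG₀, hG₀', hE⟩, ?_⟩
    refine ((hG.congr hpA hlA).singleton_of_insert hj hE).congr ?_ ?_ <;> simp [hpj, hlj]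
  | one =>
    exact ⟨0, fun x i => by simp, fun R hR => ⟨0, 1, fun x i => by simp, fun x _ => rfl,
      fun x _ => rfl, fun lam _ _ => ⟨1, one_mem _, IsPeriodization.one⟩⟩⟩
  | mul e e' _ _ he he' =>
    obtain ⟨D, hD, h⟩ := he
    obtain ⟨D', hD', h'⟩ := he'
    refine ⟨D + D', hD.mul hD', fun R hR => ?_⟩
    have hD0 : 0 ≤ D' := (abs_nonneg _).trans (hD' 0 j)
    obtain ⟨L, G, hG, hL, hR, hE⟩ := h (R + D') (by linarith)
    obtain ⟨L', G', hG', hL', hR', hE'⟩ := h' R (by linarith)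
    refine ⟨max L L', G * G', hG.mul hG', fun x hx => ?_, fun x hx => ?_, fun lam h0 hlam => ?_⟩
    · rw [Nat.cast_max, max_le_iff] at hx
      rw [Homeomorph.mul_apply, hL' x hx.2, hL x hx.1]
    · rw [Homeomorph.mul_apply, Homeomorph.mul_apply, hR' x hx, hR]
      have := hD' x j
      have := abs_sub_abs_le_abs_sub (e' x j) (x j)
      linarith
    · obtain ⟨E, hEm, hE⟩ := hE lam h0 (by omega)
      obtain ⟨E', hEm', hE'⟩ := hE' lam h0 (by omega)
      refine ⟨E * E', mul_mem hEm hEm', hE.mul (by simpa using h0) (fun x hx => hL' x ?_) hE'⟩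
      by_contra! hlt
      refine hx fun i hi => ?_
      rw [Finset.mem_singleton.1 hi]
      have h2 : (2 : ℝ) * L' ≤ lam := by
        exact_mod_cast (Nat.mul_le_mul_left 2 (le_max_right L L')).trans hlam
      have := abs_lt.1 hlt
      dsimp only
      constructor <;> linarith

end good

/-- A homeomorphism preserving a slab and fixing its walls can be replaced by the identity outside
of the slab. -/
lemma exists_eq_on_slab {j : ι} {b : ℝ} (hb : 0 ≤ b) {w : CoordHomeo ι}
    (hw : ∀ x, 0 < x j → x j < b → 0 < w x j ∧ w x j < b)
    (hw' : ∀ x, 0 < x j → x j < b → 0 < w.symm x j ∧ w.symm x j < b)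
    (hwall : ∀ x, x j = 0 ∨ x j = b → w x = x) :
    ∃ g : CoordHomeo ι, (∀ x, 0 ≤ x j → x j ≤ b → g x = w x) ∧
      ∀ x, ¬ (0 < x j ∧ x j < b) → g x = x := by
  set f : CoordHomeo ι → (ι → ℝ) → ι → ℝ := fun v x =>
    x + (v (Function.update x j (max 0 (min (x j) b))) -
      Function.update x j (max 0 (min (x j) b))) with hf
  have hcont : ∀ v : CoordHomeo ι, Continuous (f v) := fun v => by
    have : Continuous fun x : ι → ℝ => Function.update x j (max 0 (min (x j) b)) :=
      continuous_id.update j (by fun_prop)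
    exact continuous_id.add ((v.continuous.comp this).sub this)
  have hin : ∀ (v : CoordHomeo ι) (x : ι → ℝ), 0 ≤ x j → x j ≤ b → f v x = v x :=
      fun v x h0 h1 => by
    simp [hf, min_eq_left h1, max_eq_right h0]
  have hout : ∀ v : CoordHomeo ι, (∀ x : ι → ℝ, x j = 0 ∨ x j = b → v x = x) → ∀ x : ι → ℝ,
      ¬ (0 < x j ∧ x j < b) → f v x = x := fun v hv x hx => by
    have : Function.update x j (max 0 (min (x j) b)) j = 0 ∨
        Function.update x j (max 0 (min (x j) b)) j = b := by
      rw [Function.update_self]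
      by_cases h : 0 < x j
      · right
        rw [min_eq_right (not_lt.1 fun h' => hx ⟨h, h'⟩), max_eq_right hb]
      · left
        exact max_eq_left ((min_le_left _ _).trans (not_lt.1 h))
    rw [hf]
    beta_reduce
    rw [hv _ this, sub_self, add_zero]
  have hwall' : ∀ x : ι → ℝ, x j = 0 ∨ x j = b → w.symm x = x := fun x hx => by
    rw [Homeomorph.symm_apply_eq, hwall x hx]
  refine ⟨{ toFun := f w, invFun := f w.symm, left_inv := fun x => ?_, right_inv := fun x => ?_,
            continuous_toFun := hcont _, continuous_invFun := hcont _ }, hin w, hout w hwall⟩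
  · by_cases hx : 0 < x j ∧ x j < b
    · have := hw x hx.1 hx.2
      rw [hin w x hx.1.le hx.2.le, hin w.symm _ this.1.le this.2.le, Homeomorph.symm_apply_apply]
    · rw [hout w hwall x hx, hout w.symm hwall' x hx]
  · by_cases hx : 0 < x j ∧ x j < b
    · have := hw' x hx.1 hx.2
      rw [hin w.symm x hx.1.le hx.2.le, hin w _ this.1.le this.2.le, Homeomorph.apply_symm_apply]
    · rw [hout w.symm hwall' x hx, hout w hwall x hx]

/-- Bounded periodic homeomorphisms are products of periodic extensions of homeomorphisms
supported in boxes. -/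
theorem mem_good (A : Finset ι) : ∀ {S : Set (ι → ℝ)} {N : Finset ι} {c : ι → ℝ}
    {h : CoordHomeo ι} {D : ℝ} {l : ι → ℕ}, Solid c N S → Disjoint A N → DispLE D h →
    FixesOff S h → (∀ i ∈ A, 0 < l i) → Periodic A l h → h ∈ Good A S := by
  induction A using Finset.induction_on with
  | empty =>
    intro S N c h D l _ _ hD hS _ _
    refine Submonoid.subset_closure ⟨h, 0, 1, D, by simp, hD, by simpa [openBox] using hS, ?_⟩
    intro x
    have : fold ∅ (0 : ι → ℝ) 1 x = x := funext fun i => fold_of_notMem (by simp)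
    rw [this, add_sub_cancel]
  | insert j A hj ih =>
    intro S N c h D l hSc hAN hD hS hl hper
    obtain ⟨hjN, hAN'⟩ := Finset.disjoint_insert_left.1 hAN
    have hlA : ∀ i ∈ A, 0 < l i := fun i hi => hl i (Finset.mem_insert_of_mem hi)
    have hlj : 0 < l j := hl j (Finset.mem_insert_self _ _)
    have hperA : Periodic A l h := fun i hi => hper i (Finset.mem_insert_of_mem hi)
    obtain ⟨D', hD', hT⟩ := exists_trunc_of_mem_good hj hjN hAN' hSc (ih hSc hAN' hD hS hlA hperA)
    have hD0 : 0 ≤ D' := (abs_nonneg _).trans (hD' 0 j)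
    obtain ⟨L, G, hG, hGL, hGR, hE⟩ := hT (D' + D') (by linarith)
    set R := D' + D' with hR
    set lam := l j * (2 * L + ⌈2 * R⌉₊ + 1) with hlam
    have hlam1 : 2 * L + ⌈2 * R⌉₊ + 1 ≤ lam := Nat.le_mul_of_pos_left _ hlj
    have hlam0 : 0 < lam := by omega
    have hRlam : 2 * R < lam := (Nat.le_ceil _).trans_lt (by exact_mod_cast (by omega))
    obtain ⟨E, hEm, hE⟩ := hE lam hlam0 (by omega)
    have hEeq : ∀ x : ι → ℝ, |x j| ≤ R → E x = h x := fun x hx => by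
      have hx' := abs_le.1 hx
      have : fold {j} (fun _ => -(lam / 2 : ℝ)) (fun _ => lam) x = x :=
        fold_eq_of_sub_eq (m := 0) (by simpa using hlam0)
          (by rintro i hi; rw [Finset.mem_singleton.1 hi]; constructor <;> linarith)
          (by simp) (by simp)
      rw [hE, this, hGR x hx, add_sub_cancel]
    have hperj : Periodic {j} (fun _ => lam) h := by
      have : Periodic {j} l h := fun i hi => hper i (by
        rw [Finset.mem_singleton.1 hi]; exact Finset.mem_insert_self _ _)
      exact this.of_dvd fun i hi => by
        rw [Finset.mem_singleton.1 hi]; exact dvd_mul_right _ _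
    have hcylA := hSc.cylinder hAN'
    set w : CoordHomeo ι := E⁻¹ * h with hw
    have hwD : DispLE R w := (hE.dispLE hG).symm.mul hD'
    have hwS : FixesOff S w := (fixesOff_of_mem_good (hSc.cylinder hAN) hEm).symm.mul hS
    have hwj : Periodic {j} (fun _ => lam) w :=
      (hE.periodic (by simpa using hlam0)).symm.mul hperj
    have hwR : ∀ x : ι → ℝ, |x j| ≤ R → w x = x := fun x hx => by
      change E.symm (h x) = x
      rw [Homeomorph.symm_apply_eq, hEeq x hx]
    have hwR' : ∀ x : ι → ℝ, |x j - lam| ≤ R → w x = x := fun x hx => by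
      set y : ι → ℝ := x - Pi.single j (lam : ℝ) with hy
      have h1 := hwj j (Finset.mem_singleton_self j) y
      rwa [hwR y (by simpa [hy] using hx), hy, sub_add_cancel] at h1
    have hslab : ∀ v : CoordHomeo ι, DispLE R v → (∀ x : ι → ℝ, |x j| ≤ R → v x = x) →
        (∀ x : ι → ℝ, |x j - lam| ≤ R → v x = x) → ∀ x : ι → ℝ, 0 < x j → x j < lam →
        0 < v x j ∧ v x j < lam := fun v hv h1 h2 x h3 h4 => by
      by_cases h5 : |x j| ≤ R
      · rw [h1 x h5]; exact ⟨h3, h4⟩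
      by_cases h6 : |x j - lam| ≤ R
      · rw [h2 x h6]; exact ⟨h3, h4⟩
      rw [abs_of_pos h3] at h5
      rw [abs_of_neg (by linarith)] at h6
      have := abs_le.1 (hv x j)
      constructor <;> linarith
    obtain ⟨g, hgw, hgid⟩ := exists_eq_on_slab (j := j) (b := lam) (w := w) (Nat.cast_nonneg _)
      (hslab w hwD hwR hwR')
      (hslab w.symm hwD.symm (fun x hx => by rw [Homeomorph.symm_apply_eq, hwR x hx])
        fun x hx => by rw [Homeomorph.symm_apply_eq, hwR' x hx])
      (by
        rintro x (hx | hx)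
        · exact hwR x (by rw [hx, abs_zero]; linarith)
        · exact hwR' x (by rw [hx, sub_self, abs_zero]; linarith))
    obtain ⟨l', hl', hper'⟩ := exists_periodic_of_mem_good hEm
    have hwA : Periodic A (fun i => l' i * l i) w :=
      Periodic.mul (Periodic.symm fun i hi => hper'.of_dvd (fun i _ => dvd_mul_right _ _) i
        (Finset.mem_insert_of_mem hi)) (hperA.of_dvd fun i _ => dvd_mul_left _ _)
    have hgD : DispLE R g := fun x i => by
      by_cases hx : 0 < x j ∧ x j < lam
      · rw [hgw x hx.1.le hx.2.le]; exact hwD x i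
      · rw [hgid x hx, sub_self, abs_zero]; linarith
    have hgS : FixesOff (S ∩ {x | 0 < x j ∧ x j < lam}) g := fun x hx => by
      by_cases hxj : 0 < x j ∧ x j < lam
      · rw [hgw x hxj.1.le hxj.2.le, hwS x fun hxS => hx ⟨hxS, hxj⟩]
      · exact hgid x hxj
    have hgA : Periodic A (fun i => l' i * l i) g := fun i hi x => by
      have hij : j ≠ i := by rintro rfl; exact hj hi
      have hxi : (x + Pi.single i ((l' i * l i : ℕ) : ℝ) : ι → ℝ) j = x j := by
        rw [Pi.add_apply, Pi.single_eq_of_ne hij, add_zero]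
      by_cases hx : 0 < x j ∧ x j < lam
      · rw [hgw x hx.1.le hx.2.le, hgw _ (by rw [hxi]; exact hx.1.le) (by rw [hxi]; exact hx.2.le),
          hwA i hi]
      · rw [hgid x hx, hgid _ (by rwa [hxi])]
    have hgood := ih (hSc.inter_slab hjN lam) (Finset.disjoint_insert_right.2 ⟨hj, hAN'⟩) hgD hgS
      (fun i hi => Nat.mul_pos (hl' i (Finset.mem_insert_of_mem hi)) (hlA i hi)) hgA
    obtain ⟨E', hEm', hE'⟩ := exists_isPeriodization_of_mem_good hj hlam0 hcylA hgood
    have hwE : w = E' := (hwj.isPeriodization (p := 0) (by simpa using hlam0) fun x h0 h1 =>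
      hgw x h0 (by simpa using h1.le)).unique hE'
    have : h = E * E' := by rw [← hwE, hw, mul_inv_cancel_left]
    rw [this]
    exact mul_mem hEm hEm'

end CoordHomeo

namespace CoordHomeo

variable {ι : Type*}

section alexander

variable {c : ι → ℝ} {D : ℝ} {g : CoordHomeo ι}

/-- The displacement at time `t` of Alexander's isotopy from the identity to `g`. -/
noncomputable def alexanderDisp (c : ι → ℝ) (g : CoordHomeo ι) (t : I) (x : ι → ℝ) : ι → ℝ :=
  (t : ℝ) • (g (c + (t : ℝ)⁻¹ • (x - c)) - (c + (t : ℝ)⁻¹ • (x - c)))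

lemma abs_alexanderDisp_le (hg : DispLE D g) (t : I) (x : ι → ℝ) (i : ι) :
    |alexanderDisp c g t x i| ≤ t * D := by
  rw [alexanderDisp, Pi.smul_apply, smul_eq_mul, abs_mul, abs_of_nonneg t.2.1]
  exact mul_le_mul_of_nonneg_left (hg _ i) t.2.1

lemma continuous_alexanderDisp (hg : DispLE D g) :
    Continuous fun q : I × (ι → ℝ) => alexanderDisp c g q.1 q.2 := by
  refine continuous_iff_continuousAt.2 fun q => ?_
  by_cases ht : (q.1 : ℝ) = 0
  · refine continuousAt_pi.2 fun i => ?_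
    have h0 : alexanderDisp c g q.1 q.2 i = 0 := by simp [alexanderDisp, ht]
    rw [ContinuousAt, h0]
    refine squeeze_zero_norm (a := fun r : I × (ι → ℝ) => (r.1 : ℝ) * D)
      (fun r => abs_alexanderDisp_le hg r.1 r.2 i) ?_
    have hc : Continuous fun r : I × (ι → ℝ) => (r.1 : ℝ) * D := by fun_prop
    have := hc.tendsto q
    rwa [ht, zero_mul] at this
  · have h1 : ContinuousAt (fun r : I × (ι → ℝ) => (r.1 : ℝ)) q :=
      (continuous_subtype_val.comp continuous_fst).continuousAt
    have h2 : ContinuousAt (fun r : I × (ι → ℝ) => c + (r.1 : ℝ)⁻¹ • (r.2 - c)) q :=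
      continuousAt_const.add ((h1.inv₀ ht).smul (continuous_snd.sub continuous_const).continuousAt)
    exact h1.smul ((g.continuous.continuousAt.comp h2).sub h2)

lemma alexanderDisp_symm (t : I) (x : ι → ℝ) :
    alexanderDisp c g.symm t (x + alexanderDisp c g t x) = -alexanderDisp c g t x := by
  by_cases ht : (t : ℝ) = 0
  · simp [alexanderDisp, ht]
  · have : c + (t : ℝ)⁻¹ • (x + alexanderDisp c g t x - c) = g (c + (t : ℝ)⁻¹ • (x - c)) := by
      rw [alexanderDisp, add_sub_right_comm, smul_add, inv_smul_smul₀ ht]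
      abel
    rw [alexanderDisp, this, Homeomorph.symm_apply_apply, alexanderDisp, ← smul_neg, neg_sub]

/-- Alexander's isotopy from the identity to `g`, contracting towards `c`. -/
lemma exists_alexander (c : ι → ℝ) (hg : DispLE D g) :
    ∃ F : I → CoordHomeo ι, ∀ t x, F t x = x + alexanderDisp c g t x := by
  refine ⟨fun t => { toFun := fun x => x + alexanderDisp c g t x
                     invFun := fun x => x + alexanderDisp c g.symm t x
                     left_inv := fun x => ?_
                     right_inv := fun x => ?_
                     continuous_toFun := ?_
                     continuous_invFun := ?_ }, fun t x => rfl⟩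
  · beta_reduce
    rw [alexanderDisp_symm, add_neg_cancel_right]
  · beta_reduce
    have := alexanderDisp_symm (c := c) (g := g.symm) t x
    rw [Homeomorph.symm_symm] at this
    rw [this, add_neg_cancel_right]
  · exact continuous_id.add ((continuous_alexanderDisp hg).comp (Continuous.prodMk_right t))
  · exact continuous_id.add ((continuous_alexanderDisp hg.symm).comp (Continuous.prodMk_right t))

lemma Solid.alexanderDisp_eq_zero {N : Finset ι} {S : Set (ι → ℝ)} (hS : Solid c N S)
    (hg : FixesOff S g) (t : I) {x : ι → ℝ} (hx : x ∉ S) : alexanderDisp c g t x = 0 := by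
  by_cases ht : (t : ℝ) = 0
  · simp [alexanderDisp, ht]
  · rw [alexanderDisp, hg, sub_self, smul_zero]
    refine fun h => hx (hS _ h x fun i _ => ?_)
    rw [Pi.add_apply, add_sub_cancel_left, Pi.smul_apply, smul_eq_mul, abs_mul, abs_inv,
      abs_of_nonneg t.2.1, Pi.sub_apply]
    exact le_mul_of_one_le_left (abs_nonneg _)
      ((one_le_inv₀ (lt_of_le_of_ne t.2.1 (Ne.symm ht))).2 t.2.2)

end alexander

variable [DecidableEq ι]

/-- Products of periodic extensions are isotopic to the identity through periodic
homeomorphisms. -/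
theorem exists_isotopy_of_mem_good {A N : Finset ι} {S : Set (ι → ℝ)} {c : ι → ℝ}
    {e : CoordHomeo ι} (hS : Solid c N S) (hAN : Disjoint A N) (he : e ∈ Good A S) :
    ∃ (lam : ℕ) (F : I → CoordHomeo ι), 0 < lam ∧
      Continuous (fun q : I × (ι → ℝ) => F q.1 q.2) ∧ F 0 = 1 ∧ F 1 = e ∧
      ∀ t, FixesOff S (F t) ∧ Periodic A (fun _ => lam) (F t) := by
  induction he using Submonoid.closure_induction with
  | mem e he =>
    obtain ⟨g, p, l, D, hl, hD, hg, hp⟩ := he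
    set c' : ι → ℝ := fun i => if i ∈ A then p i + l i / 2 else c i
    obtain ⟨G, hG⟩ := exists_alexander c' hD
    have hsolid := hS.inter_openBox hAN p l
    have hGS : ∀ t, FixesOff (S ∩ openBox A p l) (G t) := fun t x hx => by
      rw [hG, hsolid.alexanderDisp_eq_zero hg t hx, add_zero]
    choose F hF using fun t =>
      ((hGS t).mono Set.inter_subset_right).exists_isPeriodization hl
    refine ⟨∏ i ∈ A, l i, F, Finset.prod_pos hl, ?_, ?_, ?_, fun t => ⟨?_, ?_⟩⟩
    · simp only [hF _ _]
      refine continuous_snd.add (continuous_comp_fold A hl (fun q => G q.1 q.2 - q.2) ?_ ?_)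
      · simp only [hG, add_sub_cancel_left]
        exact continuous_alexanderDisp hD
      · intro t x hx
        rw [hGS t x (exists_wall_notMem_openBox hx), sub_self]
    · refine Homeomorph.ext fun x => ?_
      simp [hF 0 x, hG, alexanderDisp]
    · refine (hF 1).unique ?_
      have : G 1 = g := Homeomorph.ext fun x => by simp [hG, alexanderDisp]
      rwa [this]
    · exact (hF t).fixesOff (hS.cylinder hAN) ((hGS t).mono Set.inter_subset_left)
    · exact ((hF t).periodic hl).of_dvd fun i hi => Finset.dvd_prod_of_mem l hi
  | one =>
    exact ⟨1, fun _ => 1, one_pos, continuous_snd, rfl, rfl,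
      fun t => ⟨fun _ _ => rfl, fun _ _ _ => rfl⟩⟩
  | mul e e' _ _ he he' =>
    obtain ⟨lam, F, h0, hF, hF0, hF1, h⟩ := he
    obtain ⟨lam', F', h0', hF', hF0', hF1', h'⟩ := he'
    refine ⟨lam * lam', fun t => F t * F' t, Nat.mul_pos h0 h0', ?_,
      by beta_reduce; rw [hF0, hF0', one_mul], by beta_reduce; rw [hF1, hF1'], fun t => ⟨(h t).1.mul (h' t).1, ?_⟩⟩
    · exact hF.comp (continuous_fst.prodMk hF')
    · exact ((h t).2.of_dvd fun _ _ => dvd_mul_right _ _).mul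
        ((h' t).2.of_dvd fun _ _ => dvd_mul_left _ _)

end CoordHomeo

namespace CoordHomeo

lemma Periodic.add_int {ι : Type*} [DecidableEq ι] [Fintype ι] {A : Finset ι} {l : ι → ℕ}
    {g : CoordHomeo ι} (h : Periodic A l g) {m : ι → ℤ} (hm : ∀ i ∉ A, m i = 0) (x : ι → ℝ) :
    g (x + fun i => (l i * m i : ℝ)) = g x + fun i => (l i * m i : ℝ) := by
  have key : ∀ B : Finset ι, g (x + ∑ i ∈ B, Pi.single i (l i * m i : ℝ)) =
      g x + ∑ i ∈ B, Pi.single i (l i * m i : ℝ) := fun B => by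
    induction B using Finset.induction_on with
    | empty => simp
    | insert i B hi ih =>
      rw [Finset.sum_insert hi, add_comm (Pi.single i _), ← add_assoc, ← add_assoc, ← ih]
      by_cases hiA : i ∈ A
      · exact h.zsmul hiA (m i) _
      · simp [hm i hiA]
  have := key Finset.univ
  rwa [Finset.univ_sum_single fun i => (l i * m i : ℝ)] at this

end CoordHomeo

section torusDisk

variable {k n : ℕ}

/-- The covering `ℝ^k → T^k`. -/
def torusMk (x : Fin k → ℝ) : Torus k := fun i => (x i : AddCircle (1 : ℝ))

lemma continuous_torusMk : Continuous (torusMk : (Fin k → ℝ) → Torus k) :=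
  continuous_pi fun i => (AddCircle.continuous_mk' 1).comp (continuous_apply i)

lemma torusMk_add (x y : Fin k → ℝ) : torusMk (x + y) = torusMk x + torusMk y :=
  funext fun _ => AddCircle.coe_add ..

lemma nsmul_torusMk (m : ℕ) (x : Fin k → ℝ) : m • torusMk x = torusMk ((m : ℝ) • x) :=
  funext fun i => by
    rw [Pi.smul_apply, torusMk, torusMk, ← AddCircle.coe_nsmul, Pi.smul_apply, nsmul_eq_mul,
      smul_eq_mul]

lemma torusMk_eq_iff {x y : Fin k → ℝ} :
    torusMk x = torusMk y ↔ ∃ m : Fin k → ℤ, ∀ i, y i = x i + m i := by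
  rw [funext_iff, ← Classical.skolem (p := fun i (m : ℤ) => y i = x i + m)]
  refine forall_congr' fun i => ?_
  rw [eq_comm, torusMk, torusMk, ← sub_eq_zero, ← AddCircle.coe_sub, AddCircle.coe_eq_zero_iff]
  refine exists_congr fun m => ?_
  rw [zsmul_one, eq_comm, sub_eq_iff_eq_add']

lemma isOpenQuotientMap_torusMk : IsOpenQuotientMap (torusMk : (Fin k → ℝ) → Torus k) :=
  IsOpenQuotientMap.piMap fun _ => QuotientAddGroup.isOpenQuotientMap_mk

/-- The point of `ℝ^(k+n)` with given components in `ℝ^k` and `D^n`. -/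
def joinCoords (x : Fin k → ℝ) (y : Disk n) : Fin k ⊕ Fin n → ℝ := Sum.elim x y.1.ofLp

/-- The component in `ℝ^n` of a point of `ℝ^(k+n)`. -/
def discPart (v : Fin k ⊕ Fin n → ℝ) : EuclideanSpace ℝ (Fin n) := WithLp.toLp 2 (v ∘ Sum.inr)

lemma continuous_discPart : Continuous (discPart : (Fin k ⊕ Fin n → ℝ) → _) :=
  (PiLp.continuous_toLp 2 _).comp (continuous_pi fun i => continuous_apply (Sum.inr i))

lemma continuous_joinCoords :
    Continuous fun q : (Fin k → ℝ) × Disk n => joinCoords q.1 q.2 := by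
  refine continuous_pi fun i => ?_
  rcases i with i | i
  · exact (continuous_apply i).comp continuous_fst
  · exact (continuous_apply i).comp
      ((PiLp.continuous_ofLp 2 _).comp (continuous_subtype_val.comp continuous_snd))

lemma discPart_joinCoords (x : Fin k → ℝ) (y : Disk n) : discPart (joinCoords x y) = y := rfl

/-- The preimage of the interior of `T^k × D^n` in `ℝ^(k+n)`. -/
def openCyl (k n : ℕ) : Set (Fin k ⊕ Fin n → ℝ) := {v | ‖discPart v‖ < 1}

lemma solid_openCyl :
    CoordHomeo.Solid 0 (Finset.univ.map (Function.Embedding.inr : Fin n ↪ Fin k ⊕ Fin n))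
      (openCyl k n) := fun x hx y hy => by
  refine lt_of_le_of_lt ?_ (show ‖discPart x‖ < 1 from hx)
  rw [EuclideanSpace.norm_eq, EuclideanSpace.norm_eq]
  refine Real.sqrt_le_sqrt (Finset.sum_le_sum fun i _ => ?_)
  have := hy (Sum.inr i) (by simp)
  simp only [Pi.zero_apply, sub_zero] at this
  exact pow_le_pow_left₀ (norm_nonneg _) this 2

lemma CoordHomeo.FixesOff.norm_discPart_le {g : CoordHomeo (Fin k ⊕ Fin n)}
    (hg : g.FixesOff (openCyl k n)) {v : Fin k ⊕ Fin n → ℝ} (hv : ‖discPart v‖ ≤ 1) :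
    ‖discPart (g v)‖ ≤ 1 := by
  by_cases h : v ∈ openCyl k n
  · exact le_of_lt (hg.mapsTo h)
  · rwa [hg v h]

/-- The coordinate directions which become periodic on `T^k × D^n`. -/
abbrev torusCoords (k n : ℕ) : Finset (Fin k ⊕ Fin n) := Finset.univ.map Function.Embedding.inl

/-- `f` is the map of `T^k × D^n` induced by the map `g` of `ℝ^(k+n)` after rescaling `ℝ^k`
by `lam`. -/
def Induces (lam : ℕ) (g : CoordHomeo (Fin k ⊕ Fin n)) (f : Torus k × Disk n → Torus k × Disk n) :
    Prop :=
  ∀ x y, (f (torusMk x, y)).1 =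
      torusMk ((lam : ℝ)⁻¹ • (g (joinCoords ((lam : ℝ) • x) y) ∘ Sum.inl)) ∧
    ((f (torusMk x, y)).2 : EuclideanSpace ℝ (Fin n)) =
      discPart (g (joinCoords ((lam : ℝ) • x) y))

lemma exists_induces {lam : ℕ} (hlam : 0 < lam) {g : CoordHomeo (Fin k ⊕ Fin n)}
    (hg : g.FixesOff (openCyl k n)) (hper : g.Periodic (torusCoords k n) fun _ => lam) :
    ∃ f, Induces lam g f := by
  have hlam' : (lam : ℝ) ≠ 0 := by positivity
  choose s hs using (isOpenQuotientMap_torusMk (k := k)).surjective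
  have hmem (p : Torus k × Disk n) :
      ‖discPart (g (joinCoords ((lam : ℝ) • s p.1) p.2))‖ ≤ 1 :=
    hg.norm_discPart_le (mem_closedBall_zero_iff.1 p.2.2)
  refine ⟨fun p => (torusMk ((lam : ℝ)⁻¹ • (g (joinCoords ((lam : ℝ) • s p.1) p.2) ∘ Sum.inl)),
    ⟨discPart (g (joinCoords ((lam : ℝ) • s p.1) p.2)), mem_closedBall_zero_iff.2 (hmem p)⟩),
    fun x y => ?_⟩
  obtain ⟨m, hm⟩ := torusMk_eq_iff.1 (hs (torusMk x)).symm
  have hj : joinCoords ((lam : ℝ) • s (torusMk x)) y = joinCoords ((lam : ℝ) • x) y +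
      fun i => (lam * (Sum.elim m 0 i : ℤ) : ℝ) := by
    funext i
    rcases i with i | i
    · simp [joinCoords, hm i, mul_add]
    · simp [joinCoords]
  have key := hper.add_int (m := Sum.elim m 0) (by rintro (i | i) hi <;> simp at hi ⊢)
    (joinCoords ((lam : ℝ) • x) y)
  rw [← hj] at key
  dsimp only
  refine ⟨(torusMk_eq_iff.2 ⟨m, fun i => ?_⟩).symm, ?_⟩
  · simp [key, mul_add, hlam']
  · rw [key]
    ext i
    simp [discPart]

namespace Induces

variable {lam : ℕ} {g g' : CoordHomeo (Fin k ⊕ Fin n)} {f f' : Torus k × Disk n → Torus k × Disk n}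

lemma comp (hlam : 0 < lam) (h : Induces lam g f) (h' : Induces lam g' f') :
    Induces lam (g * g') (f ∘ f') := fun x y => by
  have hlam' : (lam : ℝ) ≠ 0 := by positivity
  have hf := h ((lam : ℝ)⁻¹ • (g' (joinCoords ((lam : ℝ) • x) y) ∘ Sum.inl)) (f' (torusMk x, y)).2
  rw [← (h' x y).1, smul_inv_smul₀ hlam'] at hf
  have hj : joinCoords (g' (joinCoords ((lam : ℝ) • x) y) ∘ Sum.inl) (f' (torusMk x, y)).2 =
      g' (joinCoords ((lam : ℝ) • x) y) := by
    rw [joinCoords, (h' x y).2]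
    exact Sum.elim_comp_inl_inr _
  rwa [hj] at hf

lemma eq_self (hlam : 0 < lam) (h : Induces lam g f) {y : Disk n} (a : Torus k)
    (hg : ∀ x, g (joinCoords x y) = joinCoords x y) : f (a, y) = (a, y) := by
  have hlam' : (lam : ℝ) ≠ 0 := by positivity
  obtain ⟨x, rfl⟩ := isOpenQuotientMap_torusMk.surjective a
  refine Prod.ext ?_ (Subtype.ext ?_)
  · rw [(h x y).1, hg, joinCoords, Sum.elim_comp_inl, inv_smul_smul₀ hlam']
  · rw [(h x y).2, hg, discPart_joinCoords]

lemma eq_id (hlam : 0 < lam) (h : Induces lam 1 f) : f = id :=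
  funext fun p => h.eq_self hlam p.1 fun _ => rfl

lemma eq_of_norm_eq_one (hlam : 0 < lam) (h : Induces lam g f) (hg : g.FixesOff (openCyl k n))
    {p : Torus k × Disk n} (hp : p ∈ torusDiskBoundary k n) : f p = p :=
  h.eq_self hlam p.1 fun _ => hg _ fun hx => (lt_irrefl _ (hx.trans_eq hp.symm))

lemma continuous_uncurry {X : Type*} [TopologicalSpace X] {G : X → CoordHomeo (Fin k ⊕ Fin n)}
    {φ : X → Torus k × Disk n → Torus k × Disk n} (h : ∀ t, Induces lam (G t) (φ t))
    (hG : Continuous fun q : X × (Fin k ⊕ Fin n → ℝ) => G q.1 q.2) :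
    Continuous fun q : X × (Torus k × Disk n) => φ q.1 q.2 := by
  have hquot : IsOpenQuotientMap (Prod.map id (Prod.map torusMk id) :
      X × ((Fin k → ℝ) × Disk n) → X × (Torus k × Disk n)) :=
    IsOpenQuotientMap.id.prodMap (isOpenQuotientMap_torusMk.prodMap IsOpenQuotientMap.id)
  rw [← hquot.continuous_comp_iff]
  have hGj : Continuous fun q : X × ((Fin k → ℝ) × Disk n) =>
      G q.1 (joinCoords ((lam : ℝ) • q.2.1) q.2.2) :=
    hG.comp (continuous_fst.prodMk (continuous_joinCoords.comp
      ((continuous_snd.fst.const_smul (lam : ℝ)).prodMk continuous_snd.snd)))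
  have h₁ : Continuous fun q : X × ((Fin k → ℝ) × Disk n) =>
      (φ q.1 (torusMk q.2.1, q.2.2)).1 := by
    simp_rw [fun t x y => (h t x y).1]
    exact continuous_torusMk.comp (continuous_pi fun i =>
      ((continuous_apply (Sum.inl i)).comp hGj).const_smul _)
  have h₂ : Continuous fun q : X × ((Fin k → ℝ) × Disk n) =>
      (φ q.1 (torusMk q.2.1, q.2.2)).2 := by
    refine Topology.IsInducing.subtypeVal.continuous_iff.2 ?_
    simp_rw [Function.comp_def, fun t x y => (h t x y).2]
    exact continuous_discPart.comp hGj
  exact h₁.prodMk h₂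

protected lemma continuous (h : Induces lam g f) : Continuous f :=
  (continuous_uncurry (X := Unit) (G := fun _ => g) (φ := fun _ => f) (fun _ => h)
    (g.continuous.comp continuous_snd)).comp (continuous_const (y := ()).prodMk continuous_id)

end Induces

lemma exists_homeomorph_induces {lam : ℕ} (hlam : 0 < lam) {g : CoordHomeo (Fin k ⊕ Fin n)}
    (hg : g.FixesOff (openCyl k n)) (hper : g.Periodic (torusCoords k n) fun _ => lam) :
    ∃ e : (Torus k × Disk n) ≃ₜ (Torus k × Disk n), Induces lam g e := by
  obtain ⟨f, hf⟩ := exists_induces hlam hg hper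
  obtain ⟨f', hf'⟩ := exists_induces hlam hg.symm hper.symm
  have hff' : f ∘ f' = id := (mul_inv_cancel g ▸ hf.comp hlam hf' : Induces lam 1 _).eq_id hlam
  have hf'f : f' ∘ f = id := (inv_mul_cancel g ▸ hf'.comp hlam hf : Induces lam 1 _).eq_id hlam
  exact ⟨⟨⟨f, f', congrFun hf'f, congrFun hff'⟩, hf.continuous, hf'.continuous⟩, hf⟩

end torusDisk

section displacement

variable {k n : ℕ}

lemma exists_torus_displacement {f : C(Torus k × Disk n, Torus k × Disk n)}
    {S : Set (Torus k × Disk n)} (H : (ContinuousMap.id _).HomotopyRel f S) :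
    ∃ δ : C(Torus k × Disk n, Fin k → ℝ), (∀ p, (f p).1 = p.1 + torusMk (δ p)) ∧
      ∀ p ∈ S, δ p = 0 := by
  have cov := AddCircle.isCoveringMap_coe (1 : ℝ)
  let K (i : Fin k) : C(I × (Torus k × Disk n), AddCircle (1 : ℝ)) :=
    ⟨fun q => (H q).1 i - q.2.1 i, by fun_prop⟩
  have hK (i : Fin k) (p : Torus k × Disk n) :
      K i (0, p) = ((0 : C(Torus k × Disk n, ℝ)) p : AddCircle (1 : ℝ)) := by simp [K]
  let L (i : Fin k) : C(I × (Torus k × Disk n), ℝ) := cov.liftHomotopy (K i) 0 (hK i)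
  have hL (i : Fin k) (q : I × (Torus k × Disk n)) : (L i q : AddCircle (1 : ℝ)) = K i q :=
    congrFun (cov.liftHomotopy_lifts (K i) 0 (hK i)) q
  refine ⟨⟨fun p i => L i (1, p), by fun_prop⟩, fun p => funext fun i => ?_,
    fun p hp => funext fun i => ?_⟩
  · simp [torusMk, hL, K]
  · have h0 : L i (0, p) = 0 := cov.liftHomotopy_zero (K i) 0 (hK i) p
    refine Eq.trans ?_ h0
    refine cov.const_of_comp (g := fun t => L i (t, p)) (by fun_prop) (fun t t' => ?_) 1 0
    simp [hL, K, H.eq_fst _ hp]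

/-- The radial retraction of `ℝ^n` onto `D^n`. -/
noncomputable def discRetract (y : EuclideanSpace ℝ (Fin n)) : Disk n :=
  ⟨(max 1 ‖y‖)⁻¹ • y, by
    rw [mem_closedBall_zero_iff, norm_smul, norm_inv, Real.norm_of_nonneg (by positivity),
      inv_mul_le_one₀ (by positivity)]
    exact le_max_right _ _⟩

lemma continuous_discRetract : Continuous (discRetract : EuclideanSpace ℝ (Fin n) → Disk n) :=
  Continuous.subtype_mk (((continuous_const.max continuous_norm).inv₀
    fun _ => by positivity).smul continuous_id) _

lemma discRetract_coe (y : Disk n) : discRetract y.1 = y :=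
  Subtype.ext (by simp [discRetract, max_eq_left (mem_closedBall_zero_iff.1 y.2)])

lemma norm_discRetract {y : EuclideanSpace ℝ (Fin n)} (hy : 1 ≤ ‖y‖) :
    ‖(discRetract y : EuclideanSpace ℝ (Fin n))‖ = 1 := by
  simp only [discRetract, max_eq_right hy]
  rw [norm_smul, norm_inv, norm_norm, inv_mul_cancel₀ (by positivity)]

/-- The map `ℝ^(k+n) → T^k × D^n` which is the covering map over the interior of `D^n`. -/
noncomputable def cylProj (v : Fin k ⊕ Fin n → ℝ) : Torus k × Disk n :=
  (torusMk (v ∘ Sum.inl), discRetract (discPart v))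

lemma continuous_cylProj : Continuous (cylProj : (Fin k ⊕ Fin n → ℝ) → Torus k × Disk n) :=
  (continuous_torusMk.comp (continuous_pi fun i => continuous_apply (Sum.inl i))).prodMk
    (continuous_discRetract.comp continuous_discPart)

lemma cylProj_joinCoords (x : Fin k → ℝ) (y : Disk n) : cylProj (joinCoords x y) = (torusMk x, y) :=
  Prod.ext rfl (discRetract_coe y)

lemma cylProj_mem_boundary {v : Fin k ⊕ Fin n → ℝ} (hv : 1 ≤ ‖discPart v‖) :
    cylProj v ∈ torusDiskBoundary k n := norm_discRetract hv

/-- `f` moves each point `p` by the vector `d p`, which vanishes on the boundary. -/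
structure HasDisplacement (f : Torus k × Disk n → Torus k × Disk n)
    (d : Torus k × Disk n → Fin k ⊕ Fin n → ℝ) : Prop where
  fst_eq : ∀ p, (f p).1 = p.1 + torusMk (d p ∘ Sum.inl)
  snd_eq : ∀ p, ((f p).2 : EuclideanSpace ℝ (Fin n)) = p.2 + discPart (d p)
  eq_zero : ∀ p ∈ torusDiskBoundary k n, d p = 0

namespace HasDisplacement

variable {h : (Torus k × Disk n) ≃ₜ (Torus k × Disk n)}
  {f : Torus k × Disk n → Torus k × Disk n} {d : Torus k × Disk n → Fin k ⊕ Fin n → ℝ}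

lemma apply_eq (hf : HasDisplacement f d) {p : Torus k × Disk n}
    (hp : p ∈ torusDiskBoundary k n) : f p = p := by
  refine Prod.ext ?_ (Subtype.ext ?_)
  · rw [hf.fst_eq, hf.eq_zero p hp]
    funext i
    simp [torusMk]
  · rw [hf.snd_eq, hf.eq_zero p hp]
    ext i
    simp [discPart]

lemma symm (hh : HasDisplacement h d) : HasDisplacement h.symm fun p => -d (h.symm p) where
  fst_eq p := by
    have := hh.fst_eq (h.symm p)
    rw [h.apply_symm_apply] at this
    rw [this]
    funext i
    simp [torusMk]
  snd_eq p := by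
    have := hh.snd_eq (h.symm p)
    rw [h.apply_symm_apply] at this
    rw [this]
    ext i
    simp [discPart]
  eq_zero p hp := by
    rw [h.symm_apply_eq.2 (hh.apply_eq hp).symm, hh.eq_zero p hp, neg_zero]

lemma cylProj_add (hf : HasDisplacement f d) (v : Fin k ⊕ Fin n → ℝ) :
    cylProj (v + d (cylProj v)) = f (cylProj v) := by
  refine Prod.ext ?_ ?_
  · rw [hf.fst_eq]
    exact torusMk_add _ _
  · rcases le_total 1 ‖discPart v‖ with hv | hv
    · have hp := cylProj_mem_boundary hv
      rw [hf.apply_eq hp, hf.eq_zero _ hp, add_zero]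
    · have hv' : ((cylProj v).2 : EuclideanSpace ℝ (Fin n)) = discPart v :=
        congrArg Subtype.val (discRetract_coe ⟨_, mem_closedBall_zero_iff.2 hv⟩)
      rw [← discRetract_coe (f (cylProj v)).2, hf.snd_eq, hv']
      rfl

/-- The lift to `ℝ^(k+n)` of a homeomorphism of `T^k × D^n` with displacement `d`, extended by the
identity. -/
noncomputable def lift (hh : HasDisplacement h d) (hd : Continuous d) :
    CoordHomeo (Fin k ⊕ Fin n) where
  toFun v := v + d (cylProj v)
  invFun v := v + -d (h.symm (cylProj v))
  left_inv v := by
    dsimp only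
    rw [hh.cylProj_add, h.symm_apply_apply, add_neg_cancel_right]
  right_inv v := by
    dsimp only
    rw [hh.symm.cylProj_add, neg_add_cancel_right]
  continuous_toFun := continuous_id.add (hd.comp continuous_cylProj)
  continuous_invFun := continuous_id.add
    (hd.comp (h.symm.continuous.comp continuous_cylProj)).neg

lemma lift_apply (hh : HasDisplacement h d) (hd : Continuous d) (v : Fin k ⊕ Fin n → ℝ) :
    hh.lift hd v = v + d (cylProj v) := rfl

lemma fixesOff_lift (hh : HasDisplacement h d) (hd : Continuous d) :
    (hh.lift hd).FixesOff (openCyl k n) := fun v hv => by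
  rw [lift_apply, hh.eq_zero _ (cylProj_mem_boundary (not_lt.1 hv)), add_zero]

lemma periodic_lift (hh : HasDisplacement h d) (hd : Continuous d) :
    (hh.lift hd).Periodic (torusCoords k n) fun _ => 1 := fun i hi v => by
  obtain ⟨j, -, rfl⟩ := Finset.mem_map.1 hi
  have : cylProj (v + Pi.single (Sum.inl j) ((1 : ℕ) : ℝ)) = (cylProj v : Torus k × Disk n) := by
    refine Prod.ext (torusMk_eq_iff.2 ⟨Pi.single j 1, fun i => ?_⟩).symm ?_
    · simp [Pi.single_apply]
    · refine congrArg discRetract ?_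
      ext i
      simp [discPart]
  simp only [lift_apply, Function.Embedding.inl_apply, this]
  abel

lemma exists_dispLE_lift (hh : HasDisplacement h d) (hd : Continuous d) :
    ∃ D, (hh.lift hd).DispLE D := by
  have : CompactSpace (Disk n) := isCompact_iff_compactSpace.1 (isCompact_closedBall _ _)
  obtain ⟨D, hD⟩ := isCompact_univ.exists_bound_of_continuousOn hd.continuousOn
  refine ⟨D, fun v i => ?_⟩
  rw [lift_apply, Pi.add_apply, add_sub_cancel_left]
  exact (norm_le_pi_norm _ i).trans (hD _ trivial)

lemma torusMk_lift (hh : HasDisplacement h d) (hd : Continuous d) (x : Fin k → ℝ) (y : Disk n) :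
    torusMk (hh.lift hd (joinCoords x y) ∘ Sum.inl) = (h (torusMk x, y)).1 := by
  rw [lift_apply, cylProj_joinCoords, hh.fst_eq]
  exact torusMk_add _ _

lemma discPart_lift (hh : HasDisplacement h d) (hd : Continuous d) (x : Fin k → ℝ) (y : Disk n) :
    discPart (hh.lift hd (joinCoords x y)) = (h (torusMk x, y)).2 := by
  rw [lift_apply, cylProj_joinCoords, hh.snd_eq]
  rfl

end HasDisplacement

lemma exists_hasDisplacement {h : (Torus k × Disk n) ≃ₜ (Torus k × Disk n)}
    (H : (ContinuousMap.id _).HomotopyRel (h : C(Torus k × Disk n, Torus k × Disk n))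
      (torusDiskBoundary k n)) :
    ∃ d, HasDisplacement h d ∧ Continuous d := by
  obtain ⟨δ, hδ, hδ0⟩ := exists_torus_displacement H
  refine ⟨fun p => Sum.elim (δ p) ((h p).2.1 - p.2.1).ofLp, ⟨hδ, fun p => ?_, fun p hp => ?_⟩, ?_⟩
  · exact (add_sub_cancel _ _).symm
  · have hp' : h p = p := (H.fst_eq_snd hp).symm
    rw [hδ0 p hp, hp', sub_self]
    funext i
    rcases i with i | i <;> rfl
  · refine continuous_pi fun i => ?_
    rcases i with i | i
    · exact (continuous_apply i).comp δ.continuous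
    · exact (continuous_apply i).comp ((PiLp.continuous_ofLp 2 _).comp
        ((continuous_subtype_val.comp (continuous_snd.comp h.continuous)).sub
          (continuous_subtype_val.comp continuous_snd)))

end displacement
/-- **Lemma (homeomorphisms of `T^k × D^n` homotopic rel boundary to the identity have
liftings isotopic rel boundary to the identity).**
Let `h : T^k × D^n → T^k × D^n` be a homeomorphism homotopic rel `T^k × ∂D^n` to the
identity.  Then there is an integer `λ ≥ 1` and a homeomorphism `h̃` of `T^k × D^n` with
`(p_λ × 1) ∘ h̃ = h ∘ (p_λ × 1)` which is the identity on `T^k × ∂D^n` and isotopic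
rel `T^k × ∂D^n` to the identity. -/
theorem lift_isotopic_to_id (k n : ℕ)
    (h : (Torus k × Disk n) ≃ₜ (Torus k × Disk n))
    (hh : Nonempty (ContinuousMap.HomotopyRel (h : C(Torus k × Disk n, Torus k × Disk n))
      (ContinuousMap.id (Torus k × Disk n)) (torusDiskBoundary k n))) :
    ∃ lam : ℕ, 1 ≤ lam ∧
      ∃ htil : (Torus k × Disk n) ≃ₜ (Torus k × Disk n),
        (∀ p : Torus k × Disk n, plamDisk k n lam (htil p) = h (plamDisk k n lam p)) ∧
        (∀ p ∈ torusDiskBoundary k n, htil p = p) ∧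
        ∃ H : C((Torus k × Disk n) × I, Torus k × Disk n),
          (∀ p : Torus k × Disk n, H (p, 0) = htil p) ∧
          (∀ p : Torus k × Disk n, H (p, 1) = p) ∧
          (∀ t : I, ∃ e : (Torus k × Disk n) ≃ₜ (Torus k × Disk n),
            ∀ p : Torus k × Disk n, H (p, t) = e p) ∧
          (∀ (t : I), ∀ p ∈ torusDiskBoundary k n, H (p, t) = p) := by
  obtain ⟨d, hd, hdc⟩ := exists_hasDisplacement hh.some.symm
  obtain ⟨D, hD⟩ := hd.exists_dispLE_lift hdc
  have hdisj : Disjoint (torusCoords k n)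
      (Finset.univ.map (Function.Embedding.inr : Fin n ↪ Fin k ⊕ Fin n)) := by
    simp [Finset.disjoint_left]
  obtain ⟨lam, F, hlam, hF, hF0, hF1, hFt⟩ := CoordHomeo.exists_isotopy_of_mem_good
    solid_openCyl hdisj (CoordHomeo.mem_good _ solid_openCyl hdisj hD (hd.fixesOff_lift hdc)
      (fun _ _ => one_pos) (hd.periodic_lift hdc))
  choose e he using fun t => exists_homeomorph_induces hlam (hFt t).1 (hFt t).2
  have hlam' : (lam : ℝ) ≠ 0 := by positivity
  refine ⟨lam, hlam, e 1, fun p => ?_, fun p hp => (he 1).eq_of_norm_eq_one hlam (hFt 1).1 hp,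
    ⟨fun q => e (unitInterval.symm q.2) q.1,
      (Induces.continuous_uncurry he hF).comp
        ((unitInterval.continuous_symm.comp continuous_snd).prodMk continuous_fst)⟩,
    fun p => ?_, fun p => ?_, fun t => ⟨e (unitInterval.symm t), fun _ => rfl⟩,
    fun t p hp => (he _).eq_of_norm_eq_one hlam (hFt _).1 hp⟩
  · obtain ⟨a, y⟩ := p
    obtain ⟨x, rfl⟩ := isOpenQuotientMap_torusMk.surjective a
    refine Prod.ext ?_ (Subtype.ext ?_)
    · simp only [plamDisk]
      rw [(he 1 x y).1, nsmul_torusMk, nsmul_torusMk, smul_inv_smul₀ hlam', hF1, hd.torusMk_lift]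
    · simp only [plamDisk]
      rw [(he 1 x y).2, nsmul_torusMk, hF1, hd.discPart_lift]
  · exact congrArg (fun t => e t p) unitInterval.symm_zero
  · have h0 : Induces lam 1 (e 0) := hF0 ▸ he 0
    exact (congrArg (fun t => e t p) unitInterval.symm_one).trans (congrFun (h0.eq_id hlam) p)
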